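/- Suppose F : K → L²(Ω) is pointwise linearly bounded and uniformly continuous. Then for every X̄ ∈ K and every V̄ ∈ H_{X̄} there exists a generalized Lagrangian solution with initial data (X̄, V̄). -/

import Mathlib

open MeasureTheory Set Filter
open scoped ENNReal NNReal RealInnerProductSpace

noncomputable section

/-- The interval `Ω = (0,1)`. -/
def Omg : Set ℝ := Set.Ioo 0 1

/-- Lebesgue measure restricted to `(0,1)`. -/
def mu : Measure ℝ := volume.restrict Omg

/-- The Hilbert space `L²(Ω)`. -/
abbrev L2 : Type := Lp ℝ 2 mu

/-- The cone `K` of functions in `L²(Ω)` admitting a nondecreasing representative. -/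
def Kcone : Set L2 := {X | ∃ g : ℝ → ℝ, MonotoneOn g Omg ∧ ⇑X =ᵐ[mu] g}

/-- The normal cone to `K` at `X`. -/
def normalCone (X : L2) : Set L2 := {W | ∀ Y ∈ Kcone, ⟪W, Y - X⟫ ≤ 0}

/-- `Ω_X`: points of `Ω` near which `X` is (essentially) constant. -/
def OmegaX (X : L2) : Set ℝ :=
  {m | m ∈ Omg ∧ ∃ U ∈ nhds m, ∃ c : ℝ, ∀ᵐ x ∂(mu.restrict U), X x = c}

/-- The closed subspace `H_X` of functions admitting a representative that is constant on
each connected component of `Ω_X`. -/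
def HX (X : L2) : Set L2 :=
  {U | ∃ g : ℝ → ℝ, ⇑U =ᵐ[mu] g ∧
    ∀ m ∈ OmegaX X, ∀ m' ∈ connectedComponentIn (OmegaX X) m, g m' = g m}

/-- The orthogonal complement `H_X^⊥`. -/
def HXperp (X : L2) : Set L2 := {W | ∀ U ∈ HX X, ⟪W, U⟫ = 0}

/-- `P` is the metric projection of `Z` onto `K`. -/
def IsProjK (Z P : L2) : Prop := P ∈ Kcone ∧ ∀ Y ∈ Kcone, ‖P - Z‖ ≤ ‖Y - Z‖

/-- `F` is pointwise linearly bounded with constant `C_p`. -/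
def PtwLinBdd (F : L2 → L2) (Cp : ℝ) : Prop :=
  0 ≤ Cp ∧ ∀ X ∈ Kcone, ∀ᵐ m ∂mu, |F X m| ≤ Cp * (1 + |X m| + ∫ m', |X m'| ∂mu)

/-- `F` is uniformly continuous on `K`. -/
def UnifCont (F : L2 → L2) : Prop :=
  (∃ C : ℝ, 0 ≤ C ∧ ∀ X ∈ Kcone, ‖F X‖ ≤ C * (1 + ‖X‖)) ∧
  (∃ ω : ℝ → ℝ, ContinuousOn ω (Set.Ici 0) ∧ ConcaveOn ℝ (Set.Ici 0) ω ∧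
    (∀ r : ℝ, 0 ≤ r → 0 ≤ ω r) ∧ ω 0 = 0 ∧ (∀ r : ℝ, 0 < r → 0 < ω r) ∧
    ∀ X₁ ∈ Kcone, ∀ X₂ ∈ Kcone, ‖F X₁ - F X₂‖ ≤ ω ‖X₁ - X₂‖)

/-- `Z ≺ Y`: every convex lower semicontinuous integrand `φ : ℝ → [0,∞]` has
`∫ φ(Z) ≤ ∫ φ(Y)`. -/
def Dominated (Z Y : L2) : Prop :=
  ∀ φ : ℝ → ℝ≥0∞, LowerSemicontinuous φ →
    (∀ x y : ℝ, ∀ a b : ℝ≥0, a + b = 1 →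
      φ ((a : ℝ) * x + (b : ℝ) * y) ≤ (a : ℝ≥0∞) * φ x + (b : ℝ≥0∞) * φ y) →
    (∫⁻ m, φ (Z m) ∂mu) ≤ ∫⁻ m, φ (Y m) ∂mu

/-- A generalized Lagrangian solution with initial data `(X̄, V̄)`: a locally Lipschitz
curve `X : [0,∞) → K`, with everywhere-defined right derivative `V` and a locally bounded
measurable selection `Z` dominated by `F[X(t)]` with `Z(t) − F[X(t)] ∈ H_{X(t)}^⊥`,
satisfying the differential inclusion, the semigroup property, and the projection
formula. -/
def GenLagSol (F : L2 → L2) (Xbar Vbar : L2) (X V Z : ℝ → L2) : Prop :=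
  (∀ t : ℝ, 0 ≤ t → X t ∈ Kcone) ∧ X 0 = Xbar ∧
  (∀ T : ℝ, ∃ L : ℝ≥0, LipschitzOnWith L X (Set.Icc 0 T)) ∧
  (∀ t : ℝ, 0 ≤ t → HasDerivWithinAt X (V t) (Set.Ici t) t) ∧
  AEStronglyMeasurable Z (volume.restrict (Set.Ioi (0:ℝ))) ∧
  (∀ T : ℝ, 0 < T → ∃ M : ℝ, ∀ᵐ t ∂(volume.restrict (Set.Ioc (0:ℝ) T)), ‖Z t‖ ≤ M) ∧
  (∀ᵐ t ∂(volume.restrict (Set.Ioi (0:ℝ))),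
    Z t - F (X t) ∈ HXperp (X t) ∧ Dominated (Z t) (F (X t))) ∧
  (∀ᵐ t ∂(volume.restrict (Set.Ioi (0:ℝ))),
    ∃ V' : L2, HasDerivAt X V' t ∧
      (Vbar + ∫ s in Set.Ioc (0:ℝ) t, Z s) - V' ∈ normalCone (X t)) ∧
  (∀ t₁ t : ℝ, 0 ≤ t₁ → t₁ ≤ t →
    (V t₁ + ∫ s in Set.Ioc t₁ t, Z s) - V t ∈ normalCone (X t)) ∧
  (∀ t₁ t : ℝ, 0 ≤ t₁ → t₁ ≤ t →
    IsProjK (X t₁ + (t - t₁) • V t₁ + ∫ s in Set.Ioc t₁ t, (t - s) • Z s) (X t))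


/-! ### The space and the cone -/

instance : IsProbabilityMeasure mu := ⟨by simp [mu, Omg]⟩

lemma ae_mem_Omg : ∀ᵐ m ∂mu, m ∈ Omg := ae_restrict_mem measurableSet_Ioo

/-- Elements of `K` are exactly the functions that are monotone on a conull subset of `Ω`. -/
lemma mem_Kcone_iff (X : L2) : X ∈ Kcone ↔
    ∃ S, MeasurableSet S ∧ S ⊆ Omg ∧ (∀ᵐ m ∂mu, m ∈ S) ∧ MonotoneOn X S := by
  constructor
  · rintro ⟨g, hg, hXg⟩
    obtain ⟨N, hN, hNm, hN0⟩ := exists_measurable_superset_of_null (ae_iff.1 hXg)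
    refine ⟨Omg \ N, measurableSet_Ioo.diff hNm, sdiff_subset, ?_, ?_⟩
    · filter_upwards [ae_mem_Omg, compl_mem_ae_iff.2 hN0] with m h1 h2 using ⟨h1, h2⟩
    · intro a ha b hb hab
      have h1 : X a = g a := by
        by_contra h
        exact ha.2 (hN h)
      have h2 : X b = g b := by
        by_contra h
        exact hb.2 (hN h)
      rw [h1, h2]
      exact hg ha.1 hb.1 hab
  · rintro ⟨S, hSm, hSO, hS, hmono⟩
    have hvol : volume (Omg \ S) = 0 := by
      have := ae_iff.1 hS
      rw [mu, Measure.restrict_apply' (s := Omg) measurableSet_Ioo] at this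
      rw [← this]
      congr 1
      ext m
      simp [Omg, and_comm]
    have hex : ∀ a b : ℝ, a ∈ Icc (0 : ℝ) 1 → b ∈ Icc (0 : ℝ) 1 → a < b → ∃ s ∈ S, a < s ∧ s < b := by
      intro a b ha hb hab
      by_contra hcon
      push Not at hcon
      have : Ioo a b ⊆ Omg \ S := fun s hs =>
        ⟨⟨ha.1.trans_lt hs.1, hs.2.trans_le hb.2⟩, fun hsS => absurd hs.2 (not_lt.2 (hcon s hsS hs.1))⟩
      have h0 := measure_mono_null this hvol
      simp at h0
      linarith
    refine ⟨fun m => sSup (X '' (S ∩ Iic m)), ?_, ?_⟩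
    · intro a ha b hb hab
      obtain ⟨s, hsS, -, hs⟩ := hex 0 a ⟨le_rfl, zero_le_one⟩ ⟨ha.1.le, ha.2.le⟩ ha.1
      obtain ⟨r, hrS, hr, -⟩ := hex b 1 ⟨hb.1.le, hb.2.le⟩ ⟨zero_le_one, le_rfl⟩ hb.2
      refine csSup_le_csSup ?_ ⟨X s, s, ⟨hsS, hs.le⟩, rfl⟩ ?_
      · refine ⟨X r, ?_⟩
        rintro _ ⟨q, hq, rfl⟩
        exact hmono hq.1 hrS (hq.2.trans hr.le)
      · exact image_mono (inter_subset_inter_right _ (Iic_subset_Iic.2 hab))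
    · filter_upwards [hS] with m hm
      symm
      apply IsGreatest.csSup_eq
      refine ⟨⟨m, ⟨hm, self_mem_Iic⟩, rfl⟩, ?_⟩
      rintro _ ⟨q, hq, rfl⟩
      exact hmono hq.1 hm hq.2

/-- To show membership in `K` a conull set of monotonicity (not nec. measurable) suffices. -/
lemma mem_Kcone_of_ae {X : L2} {f : ℝ → ℝ} (hXf : X =ᵐ[mu] f) {S : Set ℝ} (hS : ∀ᵐ m ∂mu, m ∈ S)
    (h : MonotoneOn f S) : X ∈ Kcone := by
  rw [mem_Kcone_iff]
  have hae : ∀ᵐ m ∂mu, m ∈ S ∧ X m = f m ∧ m ∈ Omg := by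
    filter_upwards [hS, hXf, ae_mem_Omg] with m h1 h2 h3 using ⟨h1, h2, h3⟩
  obtain ⟨N, hN, hNm, hN0⟩ := exists_measurable_superset_of_null (ae_iff.1 hae)
  have key : ∀ m ∈ Nᶜ, m ∈ S ∧ X m = f m ∧ m ∈ Omg := fun m hm => by
    by_contra hcon
    exact hm (hN hcon)
  refine ⟨Nᶜ, hNm.compl, fun m hm => (key m hm).2.2, compl_mem_ae_iff.2 hN0, ?_⟩
  intro a ha b hb hab
  rw [(key a ha).2.1, (key b hb).2.1]
  exact h (key a ha).1 (key b hb).1 hab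

lemma Kcone_comp {X Y : L2} (hX : X ∈ Kcone) {φ : ℝ → ℝ} (hφ : Monotone φ)
    (hY : Y =ᵐ[mu] fun m => φ (X m)) : Y ∈ Kcone := by
  obtain ⟨S, -, -, hS, hm⟩ := (mem_Kcone_iff X).1 hX
  exact mem_Kcone_of_ae hY hS fun a ha b hb hab => hφ (hm ha hb hab)

lemma Kcone_add {X Y : L2} (hX : X ∈ Kcone) (hY : Y ∈ Kcone) : X + Y ∈ Kcone := by
  obtain ⟨S, -, -, hS, hm⟩ := (mem_Kcone_iff X).1 hX
  obtain ⟨T, -, -, hT, hn⟩ := (mem_Kcone_iff Y).1 hY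
  exact mem_Kcone_of_ae (S := S ∩ T) (Lp.coeFn_add X Y) (by filter_upwards [hS, hT] with m a b using ⟨a, b⟩)
    fun a ha b hb hab => add_le_add (hm ha.1 hb.1 hab) (hn ha.2 hb.2 hab)

lemma Kcone_smul {X : L2} (hX : X ∈ Kcone) {c : ℝ} (hc : 0 ≤ c) : c • X ∈ Kcone :=
  Kcone_comp hX (φ := fun y => c * y) (fun _ _ h => mul_le_mul_of_nonneg_left h hc) (Lp.coeFn_smul c X)

lemma Kcone_of_ae_const {X : L2} {c : ℝ} (h : X =ᵐ[mu] fun _ => c) : X ∈ Kcone :=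
  mem_Kcone_of_ae (S := univ) h (by simp) fun _ _ _ _ _ => le_rfl

lemma Kcone_zero : (0 : L2) ∈ Kcone := Kcone_of_ae_const (Lp.coeFn_zero _ _ _)

lemma Kcone_convex : Convex ℝ Kcone := fun _ hx _ hy _ _ ha hb _ =>
  Kcone_add (Kcone_smul hx ha) (Kcone_smul hy hb)

lemma Kcone_isClosed : IsClosed Kcone := by
  rw [← isSeqClosed_iff_isClosed]
  intro u X hu hlim
  have h1 : TendstoInMeasure mu (fun n => u n) atTop X :=
    tendstoInMeasure_of_tendsto_Lp hlim
  obtain ⟨ns, -, hns⟩ := h1.exists_seq_tendsto_ae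
  choose S hSm hSO hS hmono using fun n => (mem_Kcone_iff (u n)).1 (hu n)
  refine mem_Kcone_of_ae (S := {m | (∀ n, m ∈ S n) ∧ Tendsto (fun i => u (ns i) m) atTop (nhds (X m))})
    (ae_eq_refl _) ?_ ?_
  · filter_upwards [ae_all_iff.2 hS, hns] with m a b using ⟨a, b⟩
  · intro a ha b hb hab
    exact le_of_tendsto_of_tendsto' ha.2 hb.2 fun i => hmono _ (ha.1 _) (hb.1 _) hab

/-! ### The projection onto the cone -/

lemma exists_proj (Z : L2) : ∃ P ∈ Kcone, ∀ Y ∈ Kcone, ⟪Z - P, Y - P⟫ ≤ 0 := by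
  obtain ⟨P, hP, h⟩ := exists_norm_eq_iInf_of_complete_convex (K := Kcone) ⟨0, Kcone_zero⟩
    Kcone_isClosed.isComplete Kcone_convex Z
  exact ⟨P, hP, (norm_eq_iInf_iff_real_inner_le_zero Kcone_convex hP).1 h⟩

/-- The metric projection onto `K`. -/
def projK (Z : L2) : L2 := (exists_proj Z).choose

lemma projK_mem (Z : L2) : projK Z ∈ Kcone := (exists_proj Z).choose_spec.1

lemma projK_inner_sub (Z : L2) {Y : L2} (hY : Y ∈ Kcone) : ⟪Z - projK Z, Y - projK Z⟫ ≤ 0 :=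
  (exists_proj Z).choose_spec.2 Y hY

lemma inner_self_eq_zero_of_mem_normalCone {X W : L2} (hX : X ∈ Kcone) (hW : W ∈ normalCone X) :
    ⟪W, X⟫ = 0 := by
  have h1 := hW 0 Kcone_zero
  have h2 := hW ((2 : ℝ) • X) (Kcone_smul hX (by norm_num))
  rw [inner_sub_right] at h1 h2
  rw [inner_smul_right] at h2
  simp at h1
  linarith

lemma inner_nonpos_of_mem_normalCone {X W Y : L2} (hX : X ∈ Kcone) (hW : W ∈ normalCone X)
    (hY : Y ∈ Kcone) : ⟪W, Y⟫ ≤ 0 := by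
  have h1 := hW Y hY
  rw [inner_sub_right, inner_self_eq_zero_of_mem_normalCone hX hW] at h1
  linarith

lemma projK_mem_normalCone (Z : L2) : Z - projK Z ∈ normalCone (projK Z) :=
  fun _ hY => projK_inner_sub Z hY

lemma isProjK_of_mem_normalCone {Z P : L2} (hP : P ∈ Kcone) (h : Z - P ∈ normalCone P) :
    IsProjK Z P := by
  refine ⟨hP, fun Y hY => ?_⟩
  have h1 := h Y hY
  have h2 : ‖Y - Z‖ ^ 2 = ‖Y - P‖ ^ 2 - 2 * ⟪Z - P, Y - P⟫ + ‖P - Z‖ ^ 2 := by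
    have : Y - Z = (Y - P) - (Z - P) := by abel
    rw [this, norm_sub_sq_real, real_inner_comm, norm_sub_rev P Z]
  nlinarith [norm_nonneg (Y - Z), norm_nonneg (P - Z), sq_nonneg ‖Y - P‖]

lemma projK_unique {Z P : L2} (hP : P ∈ Kcone) (h : ‖Z - P‖ ≤ ‖Z - projK Z‖) : P = projK Z := by
  have h1 := projK_inner_sub Z hP
  have h2 : ‖Z - P‖ ^ 2 = ‖Z - projK Z‖ ^ 2 - 2 * ⟪Z - projK Z, P - projK Z⟫ + ‖P - projK Z‖ ^ 2 := by
    have : Z - P = (Z - projK Z) - (P - projK Z) := by abel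
    rw [this, norm_sub_sq_real]
  have h3 : ‖P - projK Z‖ = 0 := by
    nlinarith [norm_nonneg (Z - P), norm_nonneg (Z - projK Z), norm_nonneg (P - projK Z)]
  exact sub_eq_zero.1 (norm_eq_zero.1 h3)

lemma projK_of_mem {X : L2} (hX : X ∈ Kcone) : projK X = X :=
  (projK_unique hX (by simp)).symm

lemma projK_lipschitz (Z Z' : L2) : ‖projK Z - projK Z'‖ ≤ ‖Z - Z'‖ := by
  have h1 := projK_inner_sub Z (projK_mem Z')
  have h2 := projK_inner_sub Z' (projK_mem Z)
  set P := projK Z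
  set P' := projK Z'
  have h3 : ‖P - P'‖ ^ 2 ≤ ⟪Z - Z', P - P'⟫ := by
    have e : ⟪Z - Z', P - P'⟫ = - ⟪Z - P, P' - P⟫ - ⟪Z' - P', P - P'⟫ + ⟪P - P', P - P'⟫ := by
      simp only [inner_sub_left, inner_sub_right]; ring
    rw [e, real_inner_self_eq_norm_sq]
    linarith
  have h4 := real_inner_le_norm (Z - Z') (P - P')
  by_contra hcon
  push Not at hcon
  nlinarith [norm_nonneg (Z - Z')]

/-! ### Functions measurable with respect to `X`, and conditional expectations -/

/-- The σ-algebra generated by `X`. -/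
abbrev sig (X : L2) : MeasurableSpace ℝ := MeasurableSpace.comap X inferInstance

lemma measurable_L2 (X : L2) : Measurable X := (Lp.stronglyMeasurable X).measurable

lemma sig_le (X : L2) : sig X ≤ (inferInstance : MeasurableSpace ℝ) := (measurable_L2 X).comap_le

/-- The square-integrable functions that are (a.e.) Borel functions of `X`. -/
def HM (X : L2) : Submodule ℝ L2 := lpMeas ℝ ℝ (sig X) 2 mu

lemma mem_HM_iff {X U : L2} : U ∈ HM X ↔ ∃ h : ℝ → ℝ, Measurable h ∧ U =ᵐ[mu] fun m => h (X m) := by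
  rw [HM, mem_lpMeas_iff_aestronglyMeasurable]
  constructor
  · rintro ⟨g, hg, hUg⟩
    obtain ⟨h, hh, rfl⟩ := StronglyMeasurable.exists_eq_measurable_comp (f := X) hg
    exact ⟨h, hh.measurable, hUg⟩
  · rintro ⟨h, hh, hU⟩
    refine ⟨fun m => h (X m), ?_, hU⟩
    exact (hh.comp (comap_measurable X)).stronglyMeasurable

lemma self_mem_HM (X : L2) : X ∈ HM X := mem_HM_iff.2 ⟨id, measurable_id, ae_eq_refl _⟩

lemma HM_comp {X U V : L2} (hU : U ∈ HM X) {φ : ℝ → ℝ} (hφ : Measurable φ)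
    (hV : V =ᵐ[mu] fun m => φ (U m)) : V ∈ HM X := by
  obtain ⟨h, hh, hUh⟩ := mem_HM_iff.1 hU
  refine mem_HM_iff.2 ⟨fun y => φ (h y), hφ.comp hh, ?_⟩
  filter_upwards [hV, hUh] with m a b
  rw [a, b]

lemma HM_mono {X P : L2} (hP : P ∈ HM X) : HM P ≤ HM X := by
  intro U hU
  obtain ⟨h, hh, hUh⟩ := mem_HM_iff.1 hU
  exact HM_comp hP hh hUh

/-- The conditional expectation of `Y` given `X`, i.e. the projection of `Y` on `HM X`. -/
def EE (X Y : L2) : L2 := (condExpL2 ℝ ℝ (sig_le X) Y : L2)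

lemma EE_mem (X Y : L2) : EE X Y ∈ HM X := SetLike.coe_mem (condExpL2 ℝ ℝ (sig_le X) Y)

lemma inner_EE (X Y : L2) {U : L2} (hU : U ∈ HM X) : ⟪EE X Y, U⟫ = ⟪Y, U⟫ :=
  inner_condExpL2_eq_inner_fun (sig_le X) Y U (mem_lpMeas_iff_aestronglyMeasurable.1 hU)

lemma inner_sub_EE (X Y : L2) {U : L2} (hU : U ∈ HM X) : ⟪U, Y - EE X Y⟫ = 0 := by
  rw [real_inner_comm, inner_sub_left, inner_EE X Y hU, sub_self]

lemma EE_eq_of_inner {X Y V : L2} (hV : V ∈ HM X) (h : ∀ U ∈ HM X, ⟪Y - V, U⟫ = 0) : EE X Y = V := by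
  have hd : EE X Y - V ∈ HM X := (HM X).sub_mem (EE_mem X Y) hV
  have h1 := h _ hd
  have h2 : ⟪EE X Y - V, EE X Y - V⟫ = 0 := by
    rw [inner_sub_left, inner_EE X Y hd, ← inner_sub_left]
    exact h1
  exact sub_eq_zero.1 (inner_self_eq_zero.1 h2)

lemma EE_of_mem {X U : L2} (hU : U ∈ HM X) : EE X U = U :=
  EE_eq_of_inner hU (by simp)

lemma EE_sub (X Y Y' : L2) : EE X (Y - Y') = EE X Y - EE X Y' := by simp [EE]

lemma EE_smul (X : L2) (c : ℝ) (Y : L2) : EE X (c • Y) = c • EE X Y := by simp [EE]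

lemma norm_EE_le (X Y : L2) : ‖EE X Y‖ ≤ ‖Y‖ := norm_condExpL2_coe_le (sig_le X) Y

lemma norm_sub_EE_sq (X Y : L2) : ‖Y - EE X Y‖ ^ 2 = ‖Y‖ ^ 2 - ‖EE X Y‖ ^ 2 := by
  have h := inner_EE X Y (EE_mem X Y)
  rw [norm_sub_sq_real, ← h, real_inner_self_eq_norm_sq]
  ring

lemma integrable_L2 (Y : L2) : Integrable Y mu := (Lp.memLp Y).integrable one_le_two

lemma EE_ae_eq_condExp (X Y : L2) : EE X Y =ᵐ[mu] mu[Y | sig X] := by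
  have h := (Lp.memLp Y).condExpL2_ae_eq_condExp (𝕜 := ℝ) (sig_le X)
  rwa [Lp.toLp_coeFn] at h

lemma EE_le_on {X Y : L2} {B : Set ℝ} (hB : MeasurableSet B) {c : ℝ}
    (h : ∀ᵐ m ∂mu, X m ∈ B → Y m ≤ c) : ∀ᵐ m ∂mu, X m ∈ B → EE X Y m ≤ c := by
  have hA : MeasurableSet[sig X] (X ⁻¹' B) := ⟨B, hB, rfl⟩
  have h1 : (X ⁻¹' B).indicator (fun m => Y m - c) ≤ᵐ[mu] 0 := by
    filter_upwards [h] with m hm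
    by_cases hmB : X m ∈ B
    · simp [indicator, hmB, hm hmB]
    · simp [indicator, hmB]
  have h2 := condExp_mono (m := sig X)
    (((integrable_L2 Y).sub (integrable_const c)).indicator (sig_le X _ hA))
    (integrable_zero ℝ ℝ mu) h1
  have h3 := condExp_indicator (m := sig X) ((integrable_L2 Y).sub (integrable_const c)) hA
  have h4 := condExp_sub (integrable_L2 Y) (integrable_const c) (sig X) (μ := mu)
  have h5 : mu[fun _ => c | sig X] = fun _ => c := condExp_const (sig_le X) c
  have h6 : mu[(0 : ℝ → ℝ) | sig X] = 0 := condExp_zero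
  filter_upwards [h2, h3, h4, EE_ae_eq_condExp X Y] with m a b d e hm
  rw [e]
  have : (X ⁻¹' B).indicator (mu[(Y : ℝ → ℝ) - fun _ => c | sig X]) m ≤ 0 := by
    rw [← b]; rw [h6] at a; exact a
  rw [indicator_of_mem (show m ∈ X ⁻¹' B from hm), d, Pi.sub_apply, h5] at this
  linarith

lemma EE_neg (X Y : L2) : EE X (-Y) = -EE X Y := by simp [EE]

lemma EE_ge_on {X Y : L2} {B : Set ℝ} (hB : MeasurableSet B) {c : ℝ}
    (h : ∀ᵐ m ∂mu, X m ∈ B → c ≤ Y m) : ∀ᵐ m ∂mu, X m ∈ B → c ≤ EE X Y m := by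
  have h1 := EE_le_on (X := X) (Y := -Y) hB (c := -c) (by
    filter_upwards [h, Lp.coeFn_neg Y] with m a b hm
    rw [b]; simpa using a hm)
  rw [EE_neg] at h1
  filter_upwards [h1, Lp.coeFn_neg (EE X Y)] with m a b hm
  have := a hm
  rw [b] at this
  simpa using this

lemma EE_mem_Kcone {X Y : L2} (hX : X ∈ Kcone) (hY : Y ∈ Kcone) : EE X Y ∈ Kcone := by
  obtain ⟨S, -, -, hS, hm⟩ := (mem_Kcone_iff X).1 hX
  obtain ⟨T, -, -, hT, hn⟩ := (mem_Kcone_iff Y).1 hY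
  obtain ⟨h, hh, hEh⟩ := mem_HM_iff.1 (EE_mem X Y)
  have key : ∀ c : ℚ, ∃ G : Set ℝ, (∀ᵐ m ∂mu, m ∈ G) ∧
      ∀ m ∈ G, ∀ m' ∈ G, X m < c → c ≤ X m' → EE X Y m ≤ EE X Y m' := by
    intro c
    by_cases h1 : ∃ s ∈ S ∩ T, X s < c
    · by_cases h2 : ∃ s ∈ S ∩ T, (c : ℝ) ≤ X s
      · set y := sSup (Y '' (S ∩ T ∩ {m | X m < c})) with hy
        have hlt : ∀ s ∈ S ∩ T, ∀ r ∈ S ∩ T, X s < c → (c : ℝ) ≤ X r → Y s ≤ Y r := by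
          intro s hs r hr hsc hrc
          refine hn hs.2 hr.2 ?_
          by_contra hcon
          have := hm hr.1 hs.1 (not_le.1 hcon).le
          linarith
        have hle : ∀ᵐ m ∂mu, X m ∈ Iio (c : ℝ) → Y m ≤ y := by
          filter_upwards [hS, hT] with m a b hmc
          obtain ⟨r, hr, hrc⟩ := h2
          refine le_csSup ⟨Y r, ?_⟩ ⟨m, ⟨⟨a, b⟩, hmc⟩, rfl⟩
          rintro _ ⟨s, hs, rfl⟩
          exact hlt s hs.1 r hr hs.2 hrc
        have hge : ∀ᵐ m ∂mu, X m ∈ Ici (c : ℝ) → y ≤ Y m := by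
          filter_upwards [hS, hT] with m a b hmc
          obtain ⟨s, hs, hsc⟩ := h1
          refine csSup_le ⟨Y s, s, ⟨hs, hsc⟩, rfl⟩ ?_
          rintro _ ⟨r, hr, rfl⟩
          exact hlt r hr.1 m ⟨a, b⟩ hr.2 hmc
        refine ⟨{m | (X m ∈ Iio (c : ℝ) → EE X Y m ≤ y) ∧ (X m ∈ Ici (c : ℝ) → y ≤ EE X Y m)}, ?_, ?_⟩
        · filter_upwards [EE_le_on measurableSet_Iio hle, EE_ge_on measurableSet_Ici hge] with m a b
            using ⟨a, b⟩
        · intro m hm m' hm' h1 h2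
          exact (hm.1 h1).trans (hm'.2 h2)
      · refine ⟨S ∩ T, by filter_upwards [hS, hT] with m a b using ⟨a, b⟩, ?_⟩
        intro m _ m' hm' _ hc
        exact absurd ⟨m', hm', hc⟩ h2
    · refine ⟨S ∩ T, by filter_upwards [hS, hT] with m a b using ⟨a, b⟩, ?_⟩
      intro m hm m' _ hc _
      exact absurd ⟨m, hm, hc⟩ h1
  choose G hG hGm using key
  refine mem_Kcone_of_ae (S := {m | m ∈ S ∧ (∀ c, m ∈ G c) ∧ EE X Y m = h (X m)}) (ae_eq_refl _) ?_ ?_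
  · filter_upwards [hS, ae_all_iff.2 hG, hEh] with m a b c using ⟨a, b, c⟩
  · intro a ha b hb hab
    rcases (hm ha.1 hb.1 hab).eq_or_lt with h1 | h1
    · rw [ha.2.2, hb.2.2, h1]
    · obtain ⟨q, hq1, hq2⟩ := exists_rat_btwn h1
      exact hGm q a (ha.2.1 q) b (hb.2.1 q) hq1 hq2.le

/-! ### Truncations -/

/-- Truncation of a real number at height `M`. -/
def clamp (M : ℝ) (y : ℝ) : ℝ := max (-M) (min y M)

lemma clamp_lipschitz (M : ℝ) : LipschitzWith 1 (clamp M) :=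
  (LipschitzWith.id.min_const M).const_max (-M)

lemma clamp_zero {M : ℝ} (hM : 0 ≤ M) : clamp M 0 = 0 := by simp [clamp, hM]

lemma clamp_mono (M : ℝ) : Monotone (clamp M) := fun _ _ h =>
  max_le_max le_rfl (min_le_min h le_rfl)

lemma abs_clamp_le {M : ℝ} (hM : 0 ≤ M) (y : ℝ) : |clamp M y| ≤ M := by
  rw [abs_le, clamp]
  exact ⟨le_max_left _ _, max_le (by linarith) (min_le_right _ _)⟩

lemma clamp_of_abs_le {M y : ℝ} (h : |y| ≤ M) : clamp M y = y := by
  rw [abs_le] at h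
  rw [clamp, min_eq_left h.2, max_eq_right h.1]

/-- Truncation of a square-integrable function at height `|M|`. -/
def trunc (M : ℝ) (X : L2) : L2 := (clamp_lipschitz |M|).compLp (clamp_zero (abs_nonneg M)) X

lemma coeFn_trunc (M : ℝ) (X : L2) : trunc M X =ᵐ[mu] fun m => clamp |M| (X m) :=
  LipschitzWith.coeFn_compLp _ _ _

lemma norm_trunc_sub_le (M : ℝ) (X Y : L2) : ‖trunc M X - trunc M Y‖ ≤ ‖X - Y‖ := by
  have h := (clamp_lipschitz |M|).norm_compLp_sub_le (clamp_zero (abs_nonneg M)) X Y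
  rw [NNReal.coe_one, one_mul] at h
  exact h

lemma abs_trunc_le (M : ℝ) (X : L2) : ∀ᵐ m ∂mu, |trunc M X m| ≤ |M| := by
  filter_upwards [coeFn_trunc M X] with m hm
  rw [hm]
  exact abs_clamp_le (abs_nonneg M) _

lemma trunc_eq_self {M : ℝ} {X : L2} (h : ∀ᵐ m ∂mu, |X m| ≤ M) : trunc M X = X := by
  refine Lp.ext ?_
  filter_upwards [coeFn_trunc M X, h] with m a b
  rw [a, clamp_of_abs_le (b.trans (le_abs_self M))]

lemma trunc_mem_Kcone (M : ℝ) {X : L2} (hX : X ∈ Kcone) : trunc M X ∈ Kcone :=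
  Kcone_comp hX (clamp_mono _) (coeFn_trunc M X)

/-- The functions within distance `ε` of a function bounded by `M`. -/
def Bd (M ε : ℝ) : Set L2 := {X | ∃ A : L2, (∀ᵐ m ∂mu, |A m| ≤ M) ∧ ‖X - A‖ ≤ ε}

lemma exists_mem_Bd (X : L2) {ε : ℝ} (hε : 0 < ε) : ∃ M, 0 ≤ M ∧ X ∈ Bd M ε := by
  obtain ⟨g, hg, hgm⟩ := (Lp.memLp X).exists_boundedContinuous_eLpNorm_sub_le ENNReal.ofNat_ne_top
    (ε := ENNReal.ofReal ε) (by simpa using hε)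
  refine ⟨‖g‖, norm_nonneg _, hgm.toLp g, ?_, ?_⟩
  · filter_upwards [hgm.coeFn_toLp] with m hm
    rw [hm]
    exact g.norm_coe_le_norm m
  · rw [← Lp.toLp_coeFn X (Lp.memLp X), ← MemLp.toLp_sub, Lp.norm_toLp]
    exact ENNReal.toReal_le_of_le_ofReal hε.le hg

lemma tendsto_trunc (X : L2) : Tendsto (fun n : ℕ => trunc n X) atTop (nhds X) := by
  rw [Metric.tendsto_atTop]
  intro ε hε
  obtain ⟨M, hM, A, hA, hXA⟩ := exists_mem_Bd X (ε := ε / 3) (by positivity)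
  obtain ⟨N, hN⟩ := exists_nat_ge M
  refine ⟨N, fun n hn => ?_⟩
  have hn' : M ≤ n := hN.trans (by exact_mod_cast hn)
  have h1 : trunc n A = A := trunc_eq_self (by filter_upwards [hA] with m hm using hm.trans hn')
  have h2 := norm_trunc_sub_le n X A
  rw [h1] at h2
  have h3 := norm_sub_le_norm_sub_add_norm_sub (trunc n X) A X
  rw [norm_sub_rev A X] at h3
  rw [dist_eq_norm]
  linarith

/-! ### A Chebyshev inequality for conditional expectations -/

lemma inner_L2 (U W : L2) : ⟪U, W⟫ = ∫ m, U m * W m ∂mu := by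
  rw [L2.inner_def]
  refine integral_congr_ae (Eventually.of_forall fun m => ?_)
  simp [mul_comm]

lemma memLp_of_bdd {f : ℝ → ℝ} (hf : Measurable f) {M : ℝ} (hM : ∀ᵐ m ∂mu, |f m| ≤ M) :
    MemLp f 2 mu := MemLp.of_bound hf.aestronglyMeasurable M hM

lemma chebyshev_bdd {A X Y : L2} (hA : A ∈ Kcone) (hX : X ∈ Kcone) (hY : Y ∈ Kcone) {M : ℝ}
    (hM0 : 0 ≤ M) (hM : ∀ᵐ m ∂mu, |A m| ≤ M) : 0 ≤ ⟪A, Y - EE X Y⟫ := by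
  obtain ⟨S₁, -, -, hS₁, hA'⟩ := (mem_Kcone_iff A).1 hA
  obtain ⟨S₂, -, -, hS₂, hX'⟩ := (mem_Kcone_iff X).1 hX
  obtain ⟨S₃, -, -, hS₃, hY'⟩ := (mem_Kcone_iff Y).1 hY
  obtain ⟨h, hh, hE⟩ := mem_HM_iff.1 (EE_mem X Y)
  set D : ℝ → ℝ := fun m => Y m - h (X m) with hD
  set S : Set ℝ := {m | m ∈ S₁ ∧ m ∈ S₂ ∧ m ∈ S₃ ∧ |A m| ≤ M} with hSdef
  have hS : ∀ᵐ m ∂mu, m ∈ S := by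
    filter_upwards [hS₁, hS₂, hS₃, hM] with m a b c d using ⟨a, b, c, d⟩
  set T : ℝ → Set ℝ := fun c => {m | m ∈ S ∧ (X m < c ∨ X m = c ∧ D m ≤ 0)} with hT
  set α : ℝ → ℝ := fun c => sSup (insert (-M) (A '' T c)) with hα
  have hbdd : ∀ c, BddAbove (insert (-M) (A '' T c)) := by
    intro c
    refine ⟨M, ?_⟩
    rintro _ (rfl | ⟨s, hs, rfl⟩)
    · linarith
    · exact (abs_le.1 hs.1.2.2.2).2
  have hmono : Monotone α := by
    intro c d hcd
    rcases hcd.eq_or_lt with rfl | hlt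
    · exact le_rfl
    refine csSup_le_csSup (hbdd d) ⟨-M, mem_insert _ _⟩ (insert_subset_insert (image_mono ?_))
    rintro m ⟨hm, h1 | h1⟩
    · exact ⟨hm, Or.inl (h1.trans hlt)⟩
    · exact ⟨hm, Or.inl (h1.1.trans_lt hlt)⟩
  have hαb : ∀ c, |α c| ≤ M := by
    intro c
    rw [abs_le]
    refine ⟨le_csSup (hbdd c) (mem_insert _ _), csSup_le ⟨-M, mem_insert _ _⟩ ?_⟩
    rintro _ (rfl | ⟨s, hs, rfl⟩)
    · linarith
    · exact (abs_le.1 hs.1.2.2.2).2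
  have hαm : MemLp (fun m => α (X m)) 2 mu :=
    memLp_of_bdd (hmono.measurable.comp (measurable_L2 X)) (Eventually.of_forall fun m => hαb _)
  have hαH : hαm.toLp ∈ HM X := mem_HM_iff.2 ⟨α, hmono.measurable, hαm.coeFn_toLp⟩
  have h0 := inner_sub_EE X Y hαH
  have : ⟪A, Y - EE X Y⟫ = ⟪A - hαm.toLp, Y - EE X Y⟫ := by
    rw [inner_sub_left, h0, sub_zero]
  rw [this, inner_L2]
  refine integral_nonneg_of_ae ?_
  filter_upwards [hS, Lp.coeFn_sub A hαm.toLp, Lp.coeFn_sub Y (EE X Y), hαm.coeFn_toLp, hE]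
    with m hm e1 e2 e3 e4
  rw [e1, e2]
  simp only [Pi.sub_apply, Pi.zero_apply]
  rw [e3, e4]
  change 0 ≤ (A m - α (X m)) * D m
  rcases le_or_gt (D m) 0 with hd | hd
  · refine mul_nonneg_of_nonpos_of_nonpos ?_ hd
    have : A m ≤ α (X m) := le_csSup (hbdd _) (Or.inr ⟨m, ⟨hm, Or.inr ⟨rfl, hd⟩⟩, rfl⟩)
    linarith
  · refine mul_nonneg ?_ hd.le
    have : α (X m) ≤ A m := by
      refine csSup_le ⟨-M, mem_insert _ _⟩ ?_
      rintro _ (rfl | ⟨s, hs, rfl⟩)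
      · exact (abs_le.1 hm.2.2.2).1
      · refine hA' hs.1.1 hm.1 ?_
        by_contra hcon
        push Not at hcon
        have hX1 := hX' hm.2.1 hs.1.2.1 hcon.le
        have hY1 := hY' hm.2.2.1 hs.1.2.2.1 hcon.le
        rcases hs.2 with h1 | h1
        · linarith
        · have h2 : D s = Y s - h (X m) := by rw [hD]; simp only; rw [h1.1]
          have h3 : D m = Y m - h (X m) := rfl
          linarith [h1.2]
    linarith

lemma chebyshev {A X Y : L2} (hA : A ∈ Kcone) (hX : X ∈ Kcone) (hY : Y ∈ Kcone) :
    0 ≤ ⟪A, Y - EE X Y⟫ := by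
  have h1 : Tendsto (fun n : ℕ => ⟪trunc n A, Y - EE X Y⟫) atTop (nhds ⟪A, Y - EE X Y⟫) :=
    (tendsto_trunc A).inner tendsto_const_nhds
  exact ge_of_tendsto' h1 fun n => chebyshev_bdd (trunc_mem_Kcone n hA) hX hY (abs_nonneg _) (abs_trunc_le n A)

/-! ### Functions constant on the plateaus of `X` -/

lemma HX_subset_HM {X : L2} (hX : X ∈ Kcone) : HX X ⊆ HM X := by
  rintro U ⟨u, hUu, hu⟩
  obtain ⟨g, hg, hXg⟩ := hX
  set lev : ℝ → Set ℝ := fun c => {m | m ∈ Omg ∧ g m = c} with hlev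
  have hconv : ∀ c, Convex ℝ (lev c) := by
    intro c
    refine Set.OrdConnected.convex ⟨fun x hx y hy z hz => ?_⟩
    have hz' : z ∈ Omg := ⟨hx.1.1.trans_le hz.1, hz.2.trans_lt hy.1.2⟩
    refine ⟨hz', le_antisymm ?_ ?_⟩
    · rw [← hy.2]; exact hg hz' hy.1 hz.2
    · rw [← hx.2]; exact hg hx.1 hz' hz.1
  set C : Set ℝ := {c | (interior (lev c)).Nonempty} with hC
  have hCc : C.Countable := by
    refine Set.PairwiseDisjoint.countable_of_isOpen (s := fun c => interior (lev c)) ?_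
      (fun _ _ => isOpen_interior) (fun _ h => h)
    intro c _ d _ hcd
    refine Set.disjoint_left.2 fun m hm hm' => hcd ?_
    rw [← (interior_subset hm).2, (interior_subset hm').2]
  have hval : ∀ c, ∃ v, ∀ᵐ m ∂mu, g m = c → c ∈ C → U m = v := by
    intro c
    by_cases hcC : c ∈ C
    swap
    · exact ⟨0, Eventually.of_forall fun m _ h => absurd h hcC⟩
    obtain ⟨m₀, hm₀⟩ := hcC
    have hsub : interior (lev c) ⊆ OmegaX X := by
      intro m hm
      refine ⟨(interior_subset hm).1, interior (lev c), isOpen_interior.mem_nhds hm, c, ?_⟩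
      filter_upwards [ae_restrict_mem isOpen_interior.measurableSet, ae_restrict_of_ae hXg] with x h1 h2
      rw [h2, (interior_subset h1).2]
    have hcc := ((hconv c).interior.isPreconnected).subset_connectedComponentIn hm₀ hsub
    have hfr : volume (frontier (lev c)) = 0 := (hconv c).addHaar_frontier volume
    have hfr' : ∀ᵐ m ∂mu, m ∉ frontier (lev c) := by
      refine ae_restrict_of_ae ?_
      exact measure_eq_zero_iff_ae_notMem.1 hfr
    refine ⟨u m₀, ?_⟩
    filter_upwards [hfr', hUu, ae_mem_Omg] with m h1 h2 h3 h4 _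
    have : m ∈ interior (lev c) := by
      by_contra hcon
      exact h1 ⟨subset_closure ⟨h3, h4⟩, hcon⟩
    rw [h2, hu m₀ (hsub hm₀) m (hcc this)]
  choose v hv using hval
  have hae : ∀ᵐ m ∂mu, m ∈ Omg ∧ X m = g m := by
    filter_upwards [ae_mem_Omg, hXg] with m a b using ⟨a, b⟩
  obtain ⟨N, hN, hNm, hN0⟩ := exists_measurable_superset_of_null (ae_iff.1 hae)
  have key : ∀ m ∈ Nᶜ, m ∈ Omg ∧ X m = g m := fun m hm => by
    by_contra hcon
    exact hm (hN hcon)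
  set T : Set ℝ := Nᶜ ∩ X ⁻¹' Cᶜ with hT
  have hTm : MeasurableSet T := hNm.compl.inter (measurable_L2 X hCc.measurableSet.compl)
  have hinj : Function.Injective fun m : T => X m := by
    have aux : ∀ m ∈ T, ∀ m' ∈ T, X m = X m' → ¬ m < m' := by
      intro m hm m' hm' he hlt
      rw [(key m hm.1).2, (key m' hm'.1).2] at he
      refine hm.2 ?_
      rw [(key m hm.1).2]
      obtain ⟨z, hz⟩ := exists_between hlt
      refine ⟨z, mem_interior.2 ⟨Ioo m m', fun y hy => ?_, isOpen_Ioo, hz⟩⟩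
      exact ((hconv (g m)).ordConnected.out ⟨(key m hm.1).1, rfl⟩ ⟨(key m' hm'.1).1, he.symm⟩)
        ⟨hy.1.le, hy.2.le⟩
    intro m m' he
    by_contra hne
    rcases lt_or_gt_of_ne (Subtype.coe_ne_coe.2 hne) with h | h
    · exact aux _ m.2 _ m'.2 he h
    · exact aux _ m'.2 _ m.2 he.symm h
  have : StandardBorelSpace T := hTm.standardBorel
  have hemb : MeasurableEmbedding fun m : T => X m :=
    ((measurable_L2 X).comp measurable_subtype_coe).measurableEmbedding hinj
  obtain ⟨h, hh, hhU⟩ := hemb.exists_measurable_extend (g := fun m : T => U m)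
    ((measurable_L2 U).comp measurable_subtype_coe) fun _ => ⟨0⟩
  classical
  refine mem_HM_iff.2 ⟨fun y => if y ∈ C then v y else h y, ?_, ?_⟩
  · refine hh.measurable_of_countable_ne (hCc.mono fun y hy => ?_)
    by_contra hcon
    simp [hcon] at hy
  · have h5 : ∀ᵐ m ∂mu, ∀ c ∈ C, g m = c → c ∈ C → U m = v c := (ae_ball_iff hCc).2 fun c _ => hv c
    filter_upwards [h5, compl_mem_ae_iff.2 hN0] with m h1 h2
    by_cases hmC : X m ∈ C
    · simp only [hmC, if_true]
      exact h1 _ hmC (key m h2).2.symm hmC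
    · simp only [hmC, if_false]
      exact (congrFun hhU ⟨m, h2, hmC⟩).symm


/-! ### Orthogonality to functions of `X` -/

lemma orth_HM {X W : L2}
    (h : ∀ φ : ℝ → ℝ, Monotone φ → (∃ k : ℝ≥0, LipschitzWith k φ) → (∀ y, |φ y| ≤ 1) →
      ∀ Y : L2, Y =ᵐ[mu] (fun m => φ (X m)) → ⟪W, Y⟫ = 0) :
    ∀ U ∈ HM X, ⟪W, U⟫ = 0 := by
  have hint := integrable_L2 W
  have h' : ∀ φ : ℝ → ℝ, Monotone φ → (∃ k : ℝ≥0, LipschitzWith k φ) → (∀ y, |φ y| ≤ 1) →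
      ∫ m, W m * φ (X m) ∂mu = 0 := by
    intro φ h1 h2 h3
    have hm : MemLp (fun m => φ (X m)) 2 mu :=
      memLp_of_bdd (h1.measurable.comp (measurable_L2 X)) (Eventually.of_forall fun m => h3 _)
    rw [← h φ h1 h2 h3 hm.toLp hm.coeFn_toLp, inner_L2]
    refine integral_congr_ae ?_
    filter_upwards [hm.coeFn_toLp] with m e
    rw [e]
  have htot : ∫ m, W m ∂mu = 0 := by
    have := h' (fun _ => 1) monotone_const ⟨0, LipschitzWith.const _⟩ (by simp)
    simpa using this
  have hIoi : ∀ a : ℝ, ∫ m in X ⁻¹' Ioi a, W m ∂mu = 0 := by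
    intro a
    set φ : ℕ → ℝ → ℝ := fun n y => max 0 (min 1 (n * (y - a))) with hφ
    have hφ1 : ∀ n y, |φ n y| ≤ 1 := by
      intro n y
      rw [abs_of_nonneg (le_max_left _ _)]
      exact max_le zero_le_one (min_le_left _ _)
    have hmon : ∀ n, Monotone (φ n) := by
      intro n x y hxy
      have : (n : ℝ) * (x - a) ≤ n * (y - a) := by gcongr
      exact max_le_max le_rfl (min_le_min le_rfl this)
    have hlip : ∀ n : ℕ, LipschitzWith (n : ℝ≥0) (φ n) := by
      intro n
      have : LipschitzWith (n : ℝ≥0) fun y : ℝ => (n : ℝ) * (y - a) := by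
        refine LipschitzWith.of_dist_le_mul fun x y => ?_
        rw [Real.dist_eq, Real.dist_eq, ← mul_sub, abs_mul]
        simp
      exact (this.const_min 1).const_max 0
    have hz : ∀ n, ∫ m, W m * φ n (X m) ∂mu = 0 := fun n => h' _ (hmon n) ⟨_, hlip n⟩ (hφ1 n)
    have hlim : Tendsto (fun n => ∫ m, W m * φ n (X m) ∂mu) atTop
        (nhds (∫ m, (X ⁻¹' Ioi a).indicator W m ∂mu)) := by
      refine tendsto_integral_of_dominated_convergence (fun m => ‖W m‖) (fun n => ?_) hint.norm
        (fun n => Eventually.of_forall fun m => ?_) (Eventually.of_forall fun m => ?_)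
      · exact ((measurable_L2 W).mul ((hmon n).measurable.comp (measurable_L2 X))).aestronglyMeasurable
      · rw [norm_mul]
        exact mul_le_of_le_one_right (norm_nonneg _) (hφ1 n _)
      · by_cases hm : a < X m
        · rw [indicator_of_mem (show m ∈ X ⁻¹' Ioi a from hm)]
          refine tendsto_const_nhds.congr' ?_
          obtain ⟨N, hN⟩ := exists_nat_ge (1 / (X m - a))
          filter_upwards [eventually_ge_atTop N] with n hn
          have hp : 0 < X m - a := sub_pos.2 hm
          have : 1 ≤ (n : ℝ) * (X m - a) := by
            rw [div_le_iff₀ hp] at hN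
            refine hN.trans ?_
            gcongr
          simp only [hφ]
          rw [min_eq_left this, max_eq_right zero_le_one, mul_one]
        · rw [indicator_of_notMem (show m ∉ X ⁻¹' Ioi a from hm)]
          refine tendsto_const_nhds.congr fun n => ?_
          have : (n : ℝ) * (X m - a) ≤ 0 :=
            mul_nonpos_of_nonneg_of_nonpos (by positivity) (by linarith [not_lt.1 hm])
          simp only [hφ]
          rw [max_eq_left ((min_le_right _ _).trans this), mul_zero]
    simp only [hz] at hlim
    rw [← integral_indicator (measurable_L2 X measurableSet_Ioi)]
    exact (tendsto_nhds_unique hlim tendsto_const_nhds)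
  have hall : ∀ B : Set ℝ, MeasurableSet B → ∫ m in X ⁻¹' B, W m ∂mu = 0 := by
    intro B hB
    induction B, hB using MeasurableSpace.induction_on_inter
      (show (inferInstance : MeasurableSpace ℝ) = _ from
        (BorelSpace.measurable_eq (α := ℝ)).trans (borel_eq_generateFrom_Ioi ℝ))
      isPiSystem_Ioi with
    | empty => simp
    | basic t ht =>
      obtain ⟨a, rfl⟩ := ht
      exact hIoi a
    | compl t ht ih =>
      rw [preimage_compl, setIntegral_compl (measurable_L2 X ht) hint, ih, htot, sub_zero]
    | iUnion f hd hf ih =>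
      rw [preimage_iUnion, integral_iUnion (fun i => measurable_L2 X (hf i)) ?_ hint.integrableOn]
      · simp [ih]
      · intro i j hij
        exact (hd hij).preimage X
  have hE : EE X W = 0 := by
    refine Lp.ext ?_
    have h0 := ae_eq_condExp_of_forall_setIntegral_eq (sig_le X) hint (g := fun _ => (0 : ℝ))
      (fun _ _ _ => integrableOn_zero) (by
        rintro _ ⟨B, hB, rfl⟩ -
        rw [hall B hB]
        simp) aestronglyMeasurable_const
    filter_upwards [EE_ae_eq_condExp X W, h0, Lp.coeFn_zero ℝ 2 mu] with m a b c
    rw [a, ← b, c, Pi.zero_apply]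
  intro U hU
  rw [← inner_EE X W hU, hE, inner_zero_left]

lemma normalCone_orth_HM {P W : L2} (hP : P ∈ Kcone) (hW : W ∈ normalCone P) :
    ∀ U ∈ HM P, ⟪W, U⟫ = 0 := by
  refine orth_HM fun φ hφ ⟨k, hk⟩ _ Y hY => le_antisymm ?_ ?_
  · exact inner_nonpos_of_mem_normalCone hP hW (Kcone_comp hP hφ hY)
  · have h1 : (k : ℝ) • P - Y ∈ Kcone := by
      refine Kcone_comp hP (φ := fun y => k * y - φ y) (fun x y hxy => ?_) ?_
      · have := hk.dist_le_mul x y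
        rw [Real.dist_eq, Real.dist_eq, abs_sub_comm, abs_of_nonneg (sub_nonneg.2 (hφ hxy)),
          abs_sub_comm, abs_of_nonneg (sub_nonneg.2 hxy)] at this
        simp only
        linarith
      · filter_upwards [Lp.coeFn_sub ((k : ℝ) • P) Y, Lp.coeFn_smul (k : ℝ) P, hY] with m a b c
        rw [a, Pi.sub_apply, b, c]
        simp
    have h2 := inner_nonpos_of_mem_normalCone hP hW h1
    rw [inner_sub_right, inner_smul_right, inner_self_eq_zero_of_mem_normalCone hP hW] at h2
    linarith

/-! ### Equi-integrability classes -/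

lemma norm_le_of_ae {X : L2} {c : ℝ} (hc : 0 ≤ c) (h : ∀ᵐ m ∂mu, |X m| ≤ c) : ‖X‖ ≤ c := by
  have := Lp.norm_le_of_ae_bound (f := X) hc h
  simpa [measureUnivNNReal] using this

lemma Bd_mono {M M' ε ε' : ℝ} (hM : M ≤ M') (hε : ε ≤ ε') : Bd M ε ⊆ Bd M' ε' := by
  rintro X ⟨A, hA, h⟩
  exact ⟨A, by filter_upwards [hA] with m hm using hm.trans hM, h.trans hε⟩

lemma Bd_add {X Y : L2} {M N ε δ : ℝ} (hX : X ∈ Bd M ε) (hY : Y ∈ Bd N δ) :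
    X + Y ∈ Bd (M + N) (ε + δ) := by
  obtain ⟨A, hA, h⟩ := hX
  obtain ⟨B, hB, h'⟩ := hY
  refine ⟨A + B, ?_, ?_⟩
  · filter_upwards [hA, hB, Lp.coeFn_add A B] with m a b c
    rw [c, Pi.add_apply]
    exact (abs_add_le _ _).trans (add_le_add a b)
  · rw [add_sub_add_comm]
    exact (norm_add_le _ _).trans (add_le_add h h')

lemma Bd_smul {X : L2} {M ε : ℝ} (hX : X ∈ Bd M ε) {c : ℝ} (hc : 0 ≤ c) :
    c • X ∈ Bd (c * M) (c * ε) := by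
  obtain ⟨A, hA, h⟩ := hX
  refine ⟨c • A, ?_, ?_⟩
  · filter_upwards [hA, Lp.coeFn_smul c A] with m a b
    rw [b, Pi.smul_apply, smul_eq_mul, abs_mul, abs_of_nonneg hc]
    gcongr
  · rw [← smul_sub, norm_smul, Real.norm_of_nonneg hc]
    gcongr

lemma Bd_EE (X : L2) {Y : L2} {M ε : ℝ} (hY : Y ∈ Bd M ε) : EE X Y ∈ Bd M ε := by
  obtain ⟨A, hA, h⟩ := hY
  refine ⟨EE X A, ?_, ?_⟩
  · have h1 := EE_le_on (X := X) (Y := A) MeasurableSet.univ (c := M)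
      (by filter_upwards [hA] with m hm _ using (abs_le.1 hm).2)
    have h2 := EE_ge_on (X := X) (Y := A) MeasurableSet.univ (c := -M)
      (by filter_upwards [hA] with m hm _ using (abs_le.1 hm).1)
    filter_upwards [h1, h2] with m a b using abs_le.2 ⟨b trivial, a trivial⟩
  · rw [← EE_sub]
    exact (norm_EE_le _ _).trans h

lemma Bd_projK {Y : L2} {M ε : ℝ} (hY : Y ∈ Bd M ε) : projK Y ∈ Bd M ε := by
  obtain ⟨A, hA, h⟩ := hY
  have hM : 0 ≤ M := by
    obtain ⟨m, hm⟩ := hA.exists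
    exact (abs_nonneg _).trans hm
  refine ⟨projK A, ?_, (projK_lipschitz _ _).trans h⟩
  have h1 : trunc M (projK A) = projK A := by
    refine projK_unique (trunc_mem_Kcone M (projK_mem A)) ?_
    have := norm_trunc_sub_le M A (projK A)
    rwa [trunc_eq_self hA] at this
  have h2 := abs_trunc_le M (projK A)
  rwa [h1, abs_of_nonneg hM] at h2

lemma integral_abs_le_norm (X : L2) : ∫ m, |X m| ∂mu ≤ ‖X‖ := by
  have h1 : ∫ m, |X m| ∂mu = (eLpNorm X 1 mu).toReal := by
    rw [eLpNorm_one_eq_lintegral_enorm, ← integral_norm_eq_lintegral_enorm (Lp.aestronglyMeasurable X)]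
    rfl
  rw [h1, Lp.norm_def]
  exact ENNReal.toReal_mono (Lp.eLpNorm_ne_top X)
    (eLpNorm_le_eLpNorm_of_exponent_le one_le_two (Lp.aestronglyMeasurable X))

lemma Bd_F {F : L2 → L2} {Cp : ℝ} (hF : PtwLinBdd F Cp) {X : L2} (hX : X ∈ Kcone) {M ε R : ℝ}
    (hR : ‖X‖ ≤ R) (hB : X ∈ Bd M ε) : F X ∈ Bd (Cp * (1 + R + M)) (Cp * ε) := by
  obtain ⟨A, hA, h⟩ := hB
  have hCp := hF.1
  have hM : 0 ≤ M := by
    obtain ⟨m, hm⟩ := hA.exists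
    exact (abs_nonneg _).trans hm
  have hR0 : 0 ≤ R := (norm_nonneg _).trans hR
  set N := Cp * (1 + R + M) with hN
  have hN0 : 0 ≤ N := by positivity
  refine ⟨trunc N (F X), by simpa [abs_of_nonneg hN0] using abs_trunc_le N (F X), ?_⟩
  have h2 : ‖F X - trunc N (F X)‖ ≤ Cp * ‖X - A‖ := by
    refine Lp.norm_le_mul_norm_of_ae_le_mul ?_
    filter_upwards [hF.2 X hX, hA, coeFn_trunc N (F X), Lp.coeFn_sub (F X) (trunc N (F X)),
      Lp.coeFn_sub X A] with m h1 h2 h3 h4 h5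
    rw [h4, h5, Pi.sub_apply, Pi.sub_apply, h3, Real.norm_eq_abs, Real.norm_eq_abs,
      abs_of_nonneg hN0]
    have h6 : |F X m| ≤ N + Cp * |X m - A m| := by
      refine h1.trans ?_
      have h7 := (integral_abs_le_norm X).trans hR
      have h8 : |X m| ≤ |X m - A m| + M := by
        have := abs_sub_abs_le_abs_sub (X m) (A m)
        linarith
      rw [hN, ← mul_add]
      exact mul_le_mul_of_nonneg_left (by linarith) hCp
    have h9 : 0 ≤ Cp * |X m - A m| := by positivity
    rw [abs_le] at h6 ⊢
    unfold clamp
    constructor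
    · have : max (-N) (min (F X m) N) ≤ F X m + Cp * |X m - A m| :=
        max_le (by linarith) ((min_le_left _ _).trans (by linarith))
      linarith
    · rcases le_total (F X m) N with h10 | h10
      · have := le_max_right (-N) (min (F X m) N)
        rw [min_eq_left h10] at this ⊢
        linarith
      · have := le_max_right (-N) (min (F X m) N)
        rw [min_eq_right h10] at this ⊢
        linarith
  exact h2.trans (by gcongr)

/-! ### Compactness -/

/-- The indicator function of `(s,∞)` as an element of `L²(Ω)`. -/
def stp (s : ℝ) : L2 := indicatorConstLp 2 (measurableSet_Ioi (a := s)) (measure_ne_top mu _) (1 : ℝ)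

lemma coeFn_stp (s : ℝ) : stp s =ᵐ[mu] (Ioi s).indicator fun _ => (1 : ℝ) := indicatorConstLp_coeFn

lemma continuous_stp : Continuous stp := by
  refine continuous_indicatorConstLp_set ENNReal.ofNat_ne_top fun x => ?_
  have h : ∀ y, mu (symmDiff (Ioi y) (Ioi x)) ≤ ENNReal.ofReal |y - x| := by
    intro y
    have hsub : symmDiff (Ioi y) (Ioi x) ⊆ uIcc x y := by
      rintro m (⟨h1, h2⟩ | ⟨h1, h2⟩)
      · simp only [mem_Ioi, not_lt] at h1 h2
        exact mem_uIcc.2 (Or.inr ⟨h1.le, h2⟩)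
      · simp only [mem_Ioi, not_lt] at h1 h2
        exact mem_uIcc.2 (Or.inl ⟨h1.le, h2⟩)
    refine (Measure.restrict_apply_le _ _).trans ((measure_mono hsub).trans ?_)
    rw [Real.volume_interval]
  refine tendsto_of_tendsto_of_tendsto_of_le_of_le tendsto_const_nhds ?_ (fun _ => bot_le) h
  have : Tendsto (fun y => ENNReal.ofReal |y - x|) (nhds x) (nhds (ENNReal.ofReal |x - x|)) :=
    (ENNReal.continuous_ofReal.comp ((continuous_id.sub continuous_const).abs)).tendsto x
  simpa using this

/-- A superlevel set of a monotone function is a.e. a half line. -/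
lemma exists_superlevel {X : L2} (hX : X ∈ Kcone) (c : ℝ) :
    ∃ s ∈ Icc (0 : ℝ) 1, stp s =ᵐ[mu] fun m => if c ≤ X m then 1 else 0 := by
  obtain ⟨S, -, hSO, hS, hm⟩ := (mem_Kcone_iff X).1 hX
  set B : Set ℝ := insert 0 {m | m ∈ S ∧ X m < c} with hB
  have hbdd : ∀ m ∈ B, m ≤ 1 := by
    rintro m (rfl | hm)
    · exact zero_le_one
    · exact (hSO hm.1).2.le
  have hbdd' : BddAbove B := ⟨1, hbdd⟩
  refine ⟨sSup B, ⟨le_csSup hbdd' (mem_insert _ _), csSup_le ⟨0, mem_insert _ _⟩ hbdd⟩, ?_⟩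
  have hne : ∀ᵐ m ∂mu, m ≠ sSup B := by
    refine ae_restrict_of_ae ?_
    exact Measure.ae_ne volume _
  filter_upwards [hS, hne, coeFn_stp (sSup B)] with m h1 h2 h3
  rw [h3]
  rcases lt_or_gt_of_ne h2 with h | h
  · rw [indicator_of_notMem (by simpa using h.le), if_neg]
    obtain ⟨m', hm', hlt⟩ := exists_lt_of_lt_csSup ⟨0, mem_insert _ _⟩ h
    rcases hm' with rfl | hm'
    · exact absurd (hSO h1).1 (not_lt.2 hlt.le)
    · exact not_le.2 ((hm h1 hm'.1 hlt.le).trans_lt hm'.2)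
  · rw [indicator_of_mem (show m ∈ Ioi _ from h), if_pos]
    by_contra hcon
    exact absurd (le_csSup hbdd' (Or.inr ⟨h1, not_le.1 hcon⟩)) (not_le.2 h)

lemma staircase {ε y : ℝ} (hε : 0 < ε) (hy : 0 ≤ y) (J : ℕ) :
    ∑ j ∈ Finset.range J, ε * (if ((j : ℝ) + 1) * ε ≤ y then 1 else 0) ≤ min y (J * ε) ∧
    min y (J * ε) - ε ≤ ∑ j ∈ Finset.range J, ε * (if ((j : ℝ) + 1) * ε ≤ y then 1 else 0) ∧
    (J * ε ≤ y → ∑ j ∈ Finset.range J, ε * (if ((j : ℝ) + 1) * ε ≤ y then 1 else 0) = J * ε) := by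
  induction J with
  | zero => simp [hy, hε.le]
  | succ J ih =>
    obtain ⟨h1, h2, h3⟩ := ih
    rw [Finset.sum_range_succ]
    push_cast
    by_cases h : ((J : ℝ) + 1) * ε ≤ y
    · have h4 : J * ε ≤ y := by nlinarith
      rw [if_pos h, h3 h4, min_eq_right h]
      refine ⟨?_, ?_, fun _ => ?_⟩ <;> nlinarith
    · rw [if_neg h, min_eq_left (not_le.1 h).le]
      refine ⟨?_, ?_, fun h' => absurd h' h⟩
      · have := h1.trans (min_le_left _ _)
        linarith
      · rcases le_total (J * ε) y with h5 | h5
        · rw [h3 h5]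
          nlinarith
        · rw [min_eq_left h5] at h2
          linarith

lemma exists_compact_approx (M : ℝ) {ε : ℝ} (hε : 0 < ε) : ∃ C : Set L2, IsCompact C ∧
    ∀ X ∈ Kcone, (∀ᵐ m ∂mu, |X m| ≤ M) → ∃ Y ∈ C, ‖X - Y‖ ≤ ε := by
  obtain ⟨J, hJ⟩ := exists_nat_ge (2 * M / ε)
  rw [div_le_iff₀ hε] at hJ
  have hone : MemLp (fun _ : ℝ => M) 2 mu := memLp_const _
  set Φ : (Fin J → ℝ) → L2 := fun s => (∑ j, ε • stp (s j)) - hone.toLp with hΦ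
  have hΦc : Continuous Φ :=
    (continuous_finsetSum _ fun j _ =>
      (continuous_stp.comp (continuous_apply j)).const_smul ε).sub continuous_const
  refine ⟨Φ '' (Set.pi univ fun _ => Icc 0 1), (isCompact_univ_pi fun _ => isCompact_Icc).image hΦc, ?_⟩
  intro X hX hXM
  choose s hs hsX using fun j : Fin J => exists_superlevel hX ((((j : ℕ) : ℝ) + 1) * ε - M)
  refine ⟨Φ s, ⟨s, fun j _ => hs j, rfl⟩, norm_le_of_ae hε.le ?_⟩
  filter_upwards [hXM, ae_all_iff.2 hsX, Lp.coeFn_sub X (Φ s),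
    Lp.coeFn_sub (∑ j, ε • stp (s j)) hone.toLp, hone.coeFn_toLp,
    Lp.coeFn_finsetSum Finset.univ (fun j : Fin J => ε • stp (s j)),
    ae_all_iff.2 fun j : Fin J => Lp.coeFn_smul ε (stp (s j))] with m h1 h2 h3 h4 h5 h6 h7
  rw [h3, Pi.sub_apply]
  rw [hΦ]
  simp only
  rw [h4, Pi.sub_apply, h5, h6]
  simp only [Finset.sum_apply, h7, Pi.smul_apply, smul_eq_mul, h2]
  have h8 := abs_le.1 h1
  have h9 := staircase hε (y := X m + M) (by linarith) J
  rw [min_eq_left (by linarith)] at h9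
  simp only [sub_le_iff_le_add]
  rw [Fin.sum_univ_eq_sum_range (fun j => ε * (if ((j : ℝ) + 1) * ε ≤ X m + M then 1 else 0)) J, abs_le]
  constructor <;> linarith [h9.1, h9.2.1]

lemma totallyBounded_of_Bd {s : Set L2} (hs : s ⊆ Kcone) (h : ∀ ε > 0, ∃ M, s ⊆ Bd M ε) :
    TotallyBounded s := by
  rw [Metric.totallyBounded_iff]
  intro ε hε
  obtain ⟨M, hM⟩ := h (ε / 5) (by positivity)
  obtain ⟨C, hC, hCa⟩ := exists_compact_approx |M| (ε := ε / 5) (by positivity)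
  obtain ⟨t, ht, htC⟩ := Metric.totallyBounded_iff.1 hC.totallyBounded (ε / 5) (by positivity)
  refine ⟨t, ht, fun X hX => ?_⟩
  obtain ⟨A, hA, hXA⟩ := hM hX
  obtain ⟨Y, hY, hXY⟩ := hCa (trunc M X) (trunc_mem_Kcone M (hs hX)) (abs_trunc_le M X)
  obtain ⟨y, hyt, hy⟩ := mem_iUnion₂.1 (htC hY)
  refine mem_iUnion₂.2 ⟨y, hyt, ?_⟩
  rw [Metric.mem_ball, dist_eq_norm] at hy ⊢
  have h1 := norm_trunc_sub_le M X A
  rw [trunc_eq_self hA] at h1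
  have h2 : X - y = (X - A) - (trunc M X - A) + (trunc M X - Y) + (Y - y) := by abel
  rw [h2]
  have h3 := norm_add_le ((X - A) - (trunc M X - A) + (trunc M X - Y)) (Y - y)
  have h4 := norm_add_le ((X - A) - (trunc M X - A)) (trunc M X - Y)
  have h5 := norm_sub_le (X - A) (trunc M X - A)
  linarith

/-! ### The discrete scheme -/

/-- One step of size `τ` of the scheme, started at `(x, v)`. -/
def step (F : L2 → L2) (τ : ℝ) (p : L2 × L2) : L2 × L2 :=
  (projK (p.1 + τ • (p.2 + τ • EE p.1 (F p.1))),
    EE (projK (p.1 + τ • (p.2 + τ • EE p.1 (F p.1)))) (p.2 + τ • EE p.1 (F p.1)))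

lemma projK_mem_HM {x G : L2} (hx : x ∈ Kcone) (hG : G ∈ HM x) : projK G ∈ HM x := by
  have h1 : EE x (projK G) = projK G := by
    refine projK_unique (EE_mem_Kcone hx (projK_mem G)) ?_
    have := norm_EE_le x (G - projK G)
    rwa [EE_sub, EE_of_mem hG] at this
  rw [← h1]
  exact EE_mem _ _

lemma EE_add (X Y Y' : L2) : EE X (Y + Y') = EE X Y + EE X Y' := by simp [EE]

lemma EE_projK (G : L2) : EE (projK G) G = projK G :=
  EE_eq_of_inner (self_mem_HM _) (normalCone_orth_HM (projK_mem G) (projK_mem_normalCone G))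

lemma smul_sub_EE_projK (x v : L2) (τ : ℝ) :
    τ • (v - EE (projK (x + τ • v)) v) =
      (x + τ • v - projK (x + τ • v)) - (x - EE (projK (x + τ • v)) x) := by
  have h := EE_projK (x + τ • v)
  set P := projK (x + τ • v)
  rw [EE_add, EE_smul] at h
  rw [smul_sub]
  nth_rw 2 [← h]
  abel

lemma inner_sub_EE_projK_nonpos {x v Y : L2} {τ : ℝ} (hτ : 0 < τ) (hx : x ∈ Kcone) (hY : Y ∈ Kcone) :
    ⟪v - EE (projK (x + τ • v)) v, Y⟫ ≤ 0 := by
  have h1 : τ * ⟪v - EE (projK (x + τ • v)) v, Y⟫ ≤ 0 := by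
    rw [← real_inner_smul_left, smul_sub_EE_projK, inner_sub_left]
    have h2 := inner_nonpos_of_mem_normalCone (projK_mem _) (projK_mem_normalCone (x + τ • v)) hY
    have h3 := chebyshev hY (projK_mem (x + τ • v)) hx
    rw [real_inner_comm] at h3
    linarith
  exact nonpos_of_mul_nonpos_right h1 hτ

lemma norm_discrepancy_sq_le {x v : L2} (τ : ℝ) (hx : x ∈ Kcone) :
    ‖projK (x + τ • v) - x - τ • EE (projK (x + τ • v)) v‖ ^ 2 ≤
      τ ^ 2 * (‖v‖ ^ 2 - ‖EE (projK (x + τ • v)) v‖ ^ 2) := by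
  have h1 := smul_sub_EE_projK x v τ
  have h2 := EE_projK (x + τ • v)
  have h3 := projK_mem_normalCone (x + τ • v)
  have h4 := projK_mem (x + τ • v)
  set P := projK (x + τ • v)
  have h5 : P - x - τ • EE P v = -(x - EE P x) := by
    rw [EE_add, EE_smul] at h2
    nth_rw 1 [← h2]
    abel
  rw [h5, norm_neg, ← norm_sub_EE_sq, ← sq_abs τ, ← mul_pow, ← Real.norm_eq_abs, ← norm_smul, h1]
  have h6 := inner_nonpos_of_mem_normalCone h4 h3 hx
  have h7 := normalCone_orth_HM h4 h3 _ (EE_mem P x)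
  rw [norm_sub_sq_real (x + τ • v - P), inner_sub_right, h7]
  nlinarith [sq_nonneg ‖x + τ • v - P‖]

/-- A trajectory `(x, v)` of the discrete scheme with forces `z`. -/
structure Scheme (F : L2 → L2) (Xbar Vbar : L2) (τ : ℝ) (x v z : ℕ → L2) : Prop where
  x_zero : x 0 = Xbar
  v_zero : v 0 = Vbar
  z_eq : ∀ k, z k = EE (x k) (F (x k))
  x_succ : ∀ k, x (k + 1) = projK (x k + τ • (v k + τ • z k))
  v_succ : ∀ k, v (k + 1) = EE (x (k + 1)) (v k + τ • z k)

lemma exists_scheme (F : L2 → L2) (Xbar Vbar : L2) (τ : ℝ) :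
    ∃ x v z : ℕ → L2, Scheme F Xbar Vbar τ x v z := by
  refine ⟨fun k => ((step F τ)^[k] (Xbar, Vbar)).1, fun k => ((step F τ)^[k] (Xbar, Vbar)).2,
    fun k => EE ((step F τ)^[k] (Xbar, Vbar)).1 (F ((step F τ)^[k] (Xbar, Vbar)).1),
    rfl, rfl, fun _ => rfl, fun k => ?_, fun k => ?_⟩
  · simp only [Function.iterate_succ_apply']
    rfl
  · simp only [Function.iterate_succ_apply']
    rfl

namespace Scheme

variable {F : L2 → L2} {Xbar Vbar : L2} {τ : ℝ} {x v z : ℕ → L2}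

lemma x_mem (h : Scheme F Xbar Vbar τ x v z) (hX : Xbar ∈ Kcone) (k : ℕ) : x k ∈ Kcone := by
  cases k with
  | zero => rw [h.x_zero]; exact hX
  | succ k => rw [h.x_succ]; exact projK_mem _

lemma v_mem (h : Scheme F Xbar Vbar τ x v z) (hV : Vbar ∈ HM Xbar) (k : ℕ) : v k ∈ HM (x k) := by
  cases k with
  | zero => rw [h.x_zero, h.v_zero]; exact hV
  | succ k => rw [h.v_succ]; exact EE_mem _ _

lemma z_mem (h : Scheme F Xbar Vbar τ x v z) (k : ℕ) : z k ∈ HM (x k) := by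
  rw [h.z_eq]; exact EE_mem _ _

lemma x_succ_mem (h : Scheme F Xbar Vbar τ x v z) (hX : Xbar ∈ Kcone) (hV : Vbar ∈ HM Xbar) (k : ℕ) :
    x (k + 1) ∈ HM (x k) := by
  rw [h.x_succ]
  refine projK_mem_HM (h.x_mem hX k) ?_
  exact (HM _).add_mem (self_mem_HM _)
    ((HM _).smul_mem _ ((HM _).add_mem (h.v_mem hV k) ((HM _).smul_mem _ (h.z_mem k))))

lemma HM_antitone (h : Scheme F Xbar Vbar τ x v z) (hX : Xbar ∈ Kcone) (hV : Vbar ∈ HM Xbar) :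
    Antitone fun k => HM (x k) :=
  antitone_nat_of_succ_le fun k => HM_mono (h.x_succ_mem hX hV k)

lemma jump_inner_nonpos (h : Scheme F Xbar Vbar τ x v z) (hτ : 0 < τ) (hX : Xbar ∈ Kcone) (k : ℕ)
    {Y : L2} (hY : Y ∈ Kcone) : ⟪v k + τ • z k - v (k + 1), Y⟫ ≤ 0 := by
  rw [h.v_succ, h.x_succ]
  exact inner_sub_EE_projK_nonpos hτ (h.x_mem hX k) hY

lemma jump_inner_eq_zero (h : Scheme F Xbar Vbar τ x v z) (k : ℕ) {U : L2} (hU : U ∈ HM (x (k + 1))) :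
    ⟪v k + τ • z k - v (k + 1), U⟫ = 0 := by
  rw [h.v_succ, real_inner_comm]
  exact inner_sub_EE _ _ hU

lemma inner_nonpos (h : Scheme F Xbar Vbar τ x v z) (hτ : 0 < τ) (hX : Xbar ∈ Kcone)
    (hV : Vbar ∈ HM Xbar) {j r k : ℕ} (hjr : j ≤ r) (hrk : r ≤ k) {Y : L2} (hY : Y ∈ Kcone) :
    ⟪v j + τ • ∑ i ∈ Finset.Ico j r, z i - v r, Y - x k⟫ ≤ 0 := by
  have h1 : v j + τ • ∑ i ∈ Finset.Ico j r, z i - v r =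
      ∑ i ∈ Finset.Ico j r, (v i + τ • z i - v (i + 1)) := by
    have : ∀ i, v i + τ • z i - v (i + 1) = τ • z i - (v (i + 1) - v i) := fun i => by abel
    simp only [this]
    rw [Finset.sum_sub_distrib, Finset.sum_Ico_sub v hjr, ← Finset.smul_sum]
    abel
  rw [h1, sum_inner]
  refine Finset.sum_nonpos fun i hi => ?_
  have hik : i + 1 ≤ k := (Finset.mem_Ico.1 hi).2.trans_le hrk
  rw [inner_sub_right, h.jump_inner_eq_zero i (h.HM_antitone hX hV hik (self_mem_HM (x k))), sub_zero]
  exact h.jump_inner_nonpos hτ hX i hY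

lemma norm_growth (h : Scheme F Xbar Vbar τ x v z) (hτ : 0 < τ) (hτ1 : τ ≤ 1) (hX : Xbar ∈ Kcone)
    {C : ℝ} (hC : 0 ≤ C) (hF : ∀ X ∈ Kcone, ‖F X‖ ≤ C * (1 + ‖X‖)) (k : ℕ) :
    1 + ‖x k‖ + ‖v k‖ ≤ (1 + ‖Xbar‖ + ‖Vbar‖) * (1 + τ * (1 + 2 * C)) ^ k := by
  induction k with
  | zero => simp [h.x_zero, h.v_zero]
  | succ k ih =>
    have hz : ‖z k‖ ≤ C * (1 + ‖x k‖) := by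
      rw [h.z_eq]
      exact (norm_EE_le _ _).trans (hF _ (h.x_mem hX k))
    have h1 : ‖v k + τ • z k‖ ≤ ‖v k‖ + τ * (C * (1 + ‖x k‖)) := by
      refine (norm_add_le _ _).trans ?_
      rw [norm_smul, Real.norm_of_nonneg hτ.le]
      gcongr
    have h2 : ‖v (k + 1)‖ ≤ ‖v k‖ + τ * (C * (1 + ‖x k‖)) := by
      rw [h.v_succ]
      exact (norm_EE_le _ _).trans h1
    have h3 : ‖x (k + 1)‖ ≤ ‖x k‖ + τ * (‖v k‖ + τ * (C * (1 + ‖x k‖))) := by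
      have := projK_lipschitz (x k + τ • (v k + τ • z k)) 0
      rw [projK_of_mem Kcone_zero, sub_zero, sub_zero, ← h.x_succ] at this
      refine this.trans ((norm_add_le _ _).trans ?_)
      rw [norm_smul, Real.norm_of_nonneg hτ.le]
      gcongr
    have h4 : 1 + ‖x (k + 1)‖ + ‖v (k + 1)‖ ≤ (1 + ‖x k‖ + ‖v k‖) * (1 + τ * (1 + 2 * C)) := by
      have h5 : τ * (τ * (C * (1 + ‖x k‖))) ≤ 1 * (τ * (C * (1 + ‖x k‖))) := by gcongr
      have h6 : 0 ≤ τ * (C * ‖v k‖) := by positivity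
      have h7 : 0 ≤ τ * (1 + ‖x k‖) := by positivity
      nlinarith
    refine h4.trans ?_
    rw [pow_succ, ← mul_assoc]
    gcongr

lemma Bd_growth (h : Scheme F Xbar Vbar τ x v z) (hτ : 0 < τ) (hτ1 : τ ≤ 1) (hX : Xbar ∈ Kcone)
    {Cp : ℝ} (hF : PtwLinBdd F Cp) {M ε R : ℝ} (hM : 0 ≤ M) (hε : 0 ≤ ε) (hXB : Xbar ∈ Bd M ε)
    (hVB : Vbar ∈ Bd M ε) (k : ℕ) (hR : ∀ j < k, ‖x j‖ ≤ R) (hR0 : 0 ≤ R) :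
    x k ∈ Bd ((1 + R + M) * (1 + τ * (1 + Cp)) ^ k - 1 - R) (ε * (1 + τ * (1 + Cp)) ^ k) ∧
    v k ∈ Bd ((1 + R + M) * (1 + τ * (1 + Cp)) ^ k - 1 - R) (ε * (1 + τ * (1 + Cp)) ^ k) := by
  have hCp := hF.1
  induction k with
  | zero =>
    rw [h.x_zero, h.v_zero]
    have e : (1 + R + M) * (1 + τ * (1 + Cp)) ^ 0 - 1 - R = M := by ring
    rw [e, pow_zero, mul_one]
    exact ⟨hXB, hVB⟩
  | succ k ih =>
    obtain ⟨hx, hv⟩ := ih fun j hj => hR j (hj.trans k.lt_succ_self)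
    set q := 1 + τ * (1 + Cp) with hq
    have hq1 : 1 ≤ q ^ k := one_le_pow₀ (by rw [hq]; nlinarith)
    set N := (1 + R + M) * q ^ k - 1 - R with hN
    have hN0 : 0 ≤ N := by
      rw [hN]; nlinarith
    set δ := ε * q ^ k with hδ
    have hδ0 : 0 ≤ δ := by positivity
    have hz : z k ∈ Bd (Cp * (1 + R + N)) (Cp * δ) := by
      rw [h.z_eq]
      exact Bd_EE _ (Bd_F hF (h.x_mem hX k) (hR k k.lt_succ_self) hx)
    have hv' := Bd_add hv (Bd_smul hz hτ.le)
    have hx' := Bd_add hx (Bd_smul hv' hτ.le)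
    have e1 : (1 + R + M) * q ^ (k + 1) - 1 - R = N + τ * ((1 + Cp) * (1 + R + N)) := by
      rw [hN, pow_succ, hq]; ring
    have e2 : ε * q ^ (k + 1) = δ + τ * ((1 + Cp) * δ) := by
      rw [hδ, pow_succ, hq]; ring
    rw [e1, e2]
    have i1 : 0 ≤ τ * (1 + R + N) := by positivity
    have i2 : 0 ≤ τ * δ := by positivity
    have i3 : τ * (τ * (Cp * (1 + R + N))) ≤ 1 * (τ * (Cp * (1 + R + N))) := by gcongr
    have i4 : τ * (τ * (Cp * δ)) ≤ 1 * (τ * (Cp * δ)) := by gcongr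
    constructor
    · rw [h.x_succ]
      refine Bd_projK (Bd_mono ?_ ?_ hx') <;> nlinarith
    · rw [h.v_succ]
      refine Bd_EE _ (Bd_mono ?_ ?_ hv') <;> nlinarith

end Scheme

lemma growth_pow_le_exp {τ c T : ℝ} {k : ℕ} (hτ : 0 ≤ τ) (hc : 0 ≤ c) (hk : τ * k ≤ T) :
    (1 + τ * c) ^ k ≤ Real.exp (c * T) := by
  have h1 : 1 + τ * c ≤ Real.exp (τ * c) := by
    have := Real.add_one_le_exp (τ * c)
    linarith
  refine (pow_le_pow_left₀ (by positivity) h1 k).trans ?_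
  rw [← Real.exp_nat_mul, Real.exp_le_exp]
  nlinarith

namespace Scheme

variable {F : L2 → L2} {Xbar Vbar : L2}

/-- Bounds on the discrete trajectories that are uniform in the time step. -/
lemma exists_bound (hF : UnifCont F) (hX : Xbar ∈ Kcone) (Vbar : L2) (T : ℝ) :
    ∃ B : ℝ, 0 ≤ B ∧ ∀ (τ : ℝ) (x v z : ℕ → L2), 0 < τ → τ ≤ 1 → Scheme F Xbar Vbar τ x v z →
      ∀ k : ℕ, τ * k ≤ T → ‖x k‖ ≤ B ∧ ‖v k‖ ≤ B ∧ ‖z k‖ ≤ B ∧ ‖x (k + 1) - x k‖ ≤ τ * B ∧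
        (∑ i ∈ Finset.range k, ‖x (i + 1) - x i - τ • v (i + 1)‖) ^ 2 ≤ τ * B := by
  obtain ⟨⟨C, hC, hFC⟩, -⟩ := hF
  set R := (1 + ‖Xbar‖ + ‖Vbar‖) * Real.exp ((1 + 2 * C) * T) with hR
  have hR0 : 0 ≤ R := by positivity
  set B' := ‖Vbar‖ ^ 2 + |T| * (2 * R * (C * R) + (C * R) ^ 2) with hB'
  have hB'0 : 0 ≤ B' := by positivity
  refine ⟨R + C * R + |T| * B', by positivity, ?_⟩
  intro τ x v z hτ hτ1 h
  have hp1 : 0 ≤ C * R := by positivity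
  have hp2 : 0 ≤ |T| * B' := by positivity
  have hxv : ∀ k : ℕ, τ * k ≤ T → 1 + ‖x k‖ + ‖v k‖ ≤ R := fun k hk =>
    (h.norm_growth hτ hτ1 hX hC hFC k).trans
      (mul_le_mul_of_nonneg_left (growth_pow_le_exp hτ.le (by positivity) hk) (by positivity))
  have hz : ∀ k : ℕ, τ * k ≤ T → ‖z k‖ ≤ C * R := by
    intro k hk
    rw [h.z_eq]
    refine (norm_EE_le _ _).trans ((hFC _ (h.x_mem hX k)).trans ?_)
    have := hxv k hk
    have := norm_nonneg (v k)
    gcongr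
    linarith
  have hv' : ∀ k : ℕ, τ * k ≤ T → ‖v k + τ • z k‖ ≤ ‖v k‖ + τ * (C * R) := by
    intro k hk
    refine (norm_add_le _ _).trans ?_
    rw [norm_smul, Real.norm_of_nonneg hτ.le]
    have := hz k hk
    gcongr
  intro k hk
  have hxvk := hxv k hk
  have n1 := norm_nonneg (x k)
  have n2 := norm_nonneg (v k)
  refine ⟨by linarith, by linarith, by linarith [hz k hk], ?_, ?_⟩
  · have h1 := projK_lipschitz (x k + τ • (v k + τ • z k)) (x k)
    rw [projK_of_mem (h.x_mem hX k), ← h.x_succ, add_sub_cancel_left, norm_smul,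
      Real.norm_of_nonneg hτ.le] at h1
    refine h1.trans ?_
    have := hv' k hk
    have : τ * (C * R) ≤ 1 * (C * R) := by gcongr
    gcongr
    linarith
  · have hkle : ∀ i : ℕ, i ≤ k → τ * i ≤ T := fun i hi => by
      refine le_trans ?_ hk
      gcongr
    have hsq : ∀ n ≤ k, ∑ i ∈ Finset.range n, ‖x (i + 1) - x i - τ • v (i + 1)‖ ^ 2 ≤
        τ ^ 2 * (‖Vbar‖ ^ 2 + n * τ * (2 * R * (C * R) + (C * R) ^ 2) - ‖v n‖ ^ 2) := by
      intro n
      induction n with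
      | zero => simp [h.v_zero]
      | succ n ih =>
        intro hn
        rw [Finset.sum_range_succ]
        have hnT := hkle n (by omega)
        have h2 := norm_discrepancy_sq_le (v := v n + τ • z n) τ (h.x_mem hX n)
        rw [← h.x_succ, ← h.v_succ] at h2
        have h3 : ‖v n + τ • z n‖ ^ 2 ≤ ‖v n‖ ^ 2 + τ * (2 * R * (C * R) + (C * R) ^ 2) := by
          have h4 := hv' n hnT
          have h5 := hxv n hnT
          have h6 : ‖v n‖ ≤ R := by linarith [norm_nonneg (x n)]
          have h7 : ‖v n + τ • z n‖ ^ 2 ≤ (‖v n‖ + τ * (C * R)) ^ 2 := by gcongr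
          have h8 : τ * (C * R) * ‖v n‖ ≤ τ * (C * R) * R := by gcongr
          have h9 : τ * (τ * (C * R) ^ 2) ≤ 1 * (τ * (C * R) ^ 2) := by gcongr
          nlinarith
        have h10 := ih (by omega)
        have h11 := mul_le_mul_of_nonneg_left h3 (sq_nonneg τ)
        push_cast
        nlinarith
    have h1 := sq_sum_le_card_mul_sum_sq (s := Finset.range k)
      (f := fun i => ‖x (i + 1) - x i - τ • v (i + 1)‖)
    rw [Finset.card_range] at h1
    refine h1.trans ((mul_le_mul_of_nonneg_left (hsq k le_rfl) k.cast_nonneg).trans ?_)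
    have hkT : τ * k ≤ |T| := hk.trans (le_abs_self T)
    have h2 : ‖Vbar‖ ^ 2 + k * τ * (2 * R * (C * R) + (C * R) ^ 2) - ‖v k‖ ^ 2 ≤ B' := by
      have h3 : k * τ * (2 * R * (C * R) + (C * R) ^ 2) ≤ |T| * (2 * R * (C * R) + (C * R) ^ 2) := by
        rw [mul_comm (k : ℝ)]
        gcongr
      have := sq_nonneg ‖v k‖
      linarith
    calc (k : ℝ) * (τ ^ 2 * (‖Vbar‖ ^ 2 + k * τ * (2 * R * (C * R) + (C * R) ^ 2) - ‖v k‖ ^ 2))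
        ≤ k * (τ ^ 2 * B') := by gcongr
      _ = τ * ((τ * k) * B') := by ring
      _ ≤ τ * (|T| * B') := by gcongr
      _ ≤ τ * (R + C * R + |T| * B') := by gcongr; linarith

/-- The discrete trajectories on a bounded time interval live in a common compact set. -/
lemma exists_compact {Cp : ℝ} (hp : PtwLinBdd F Cp) (hF : UnifCont F) (hX : Xbar ∈ Kcone) (Vbar : L2)
    (T : ℝ) : ∃ S : Set L2, IsCompact S ∧ ∀ (τ : ℝ) (x v z : ℕ → L2), 0 < τ → τ ≤ 1 →
      Scheme F Xbar Vbar τ x v z → ∀ k : ℕ, τ * k ≤ T → x k ∈ S := by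
  set s : Set L2 := {y | ∃ (τ : ℝ) (x v z : ℕ → L2) (k : ℕ), 0 < τ ∧ τ ≤ 1 ∧
      Scheme F Xbar Vbar τ x v z ∧ τ * k ≤ T ∧ y = x k} with hs
  refine ⟨closure s, ?_, fun τ x v z h0 h1 h2 k hk =>
    subset_closure ⟨τ, x, v, z, k, h0, h1, h2, hk, rfl⟩⟩
  refine isCompact_iff_totallyBounded_isComplete.2
    ⟨TotallyBounded.closure ?_, isClosed_closure.isComplete⟩
  have hCp := hp.1
  refine totallyBounded_of_Bd ?_ ?_
  · rintro y ⟨τ, x, v, z, k, h0, h1, h2, hk, rfl⟩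
    exact h2.x_mem hX k
  · intro ε hε
    obtain ⟨R, hR0, hR⟩ := exists_bound hF hX Vbar T
    set E := Real.exp ((1 + Cp) * T) with hE
    have hE0 : 0 < E := Real.exp_pos _
    obtain ⟨M₁, hM₁, h₁⟩ := exists_mem_Bd Xbar (ε := ε / E) (by positivity)
    obtain ⟨M₂, hM₂, h₂⟩ := exists_mem_Bd Vbar (ε := ε / E) (by positivity)
    refine ⟨(1 + R + max M₁ M₂) * E, ?_⟩
    rintro y ⟨τ, x, v, z, k, h0, h1, h, hk, rfl⟩
    have hRk : ∀ j < k, ‖x j‖ ≤ R := fun j hj => by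
      refine (hR τ x v z h0 h1 h j (le_trans ?_ hk)).1
      gcongr
    have h3 := (h.Bd_growth h0 h1 hX hp (hM₁.trans (le_max_left M₁ M₂)) (by positivity)
      (Bd_mono (le_max_left _ _) le_rfl h₁) (Bd_mono (le_max_right _ _) le_rfl h₂) k hRk hR0).1
    have h4 := growth_pow_le_exp (k := k) h0.le (by positivity : 0 ≤ 1 + Cp) hk
    refine Bd_mono ?_ ?_ h3
    · have : 0 ≤ 1 + R + max M₁ M₂ := by positivity
      have := mul_le_mul_of_nonneg_left h4 this
      linarith
    · calc ε / E * (1 + τ * (1 + Cp)) ^ k ≤ ε / E * E := by gcongr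
        _ = ε := by field_simp

end Scheme

/-! ### Weak limits along ultrafilters and time discretization -/

lemma exists_weak_limit {H ι : Type*} [NormedAddCommGroup H] [InnerProductSpace ℝ H] [CompleteSpace H]
    (U : Ultrafilter ι) (f : ι → H) {B : ℝ} (hB : ∀ᶠ i in (U : Filter ι), ‖f i‖ ≤ B) :
    ∃ w : H, ‖w‖ ≤ B ∧ ∀ y, Tendsto (fun i => ⟪f i, y⟫) U (nhds ⟪w, y⟫) := by
  set g : ι → WeakDual ℝ H := fun i => StrongDual.toWeakDual (InnerProductSpace.toDual ℝ H (f i)) with hg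
  have hK := WeakDual.isCompact_closedBall (𝕜 := ℝ) (0 : StrongDual ℝ H) B
  have hmem : ∀ᶠ i in (U : Filter ι),
      g i ∈ WeakDual.toStrongDual ⁻¹' Metric.closedBall (0 : StrongDual ℝ H) B := by
    filter_upwards [hB] with i hi
    simpa [hg] using hi
  obtain ⟨L, hL, hLim⟩ := hK.ultrafilter_le_nhds (U.map g) (le_principal_iff.2 hmem)
  refine ⟨(InnerProductSpace.toDual ℝ H).symm (WeakDual.toStrongDual L), ?_, fun y => ?_⟩
  · simpa using hL
  · have h1 : Tendsto g U (nhds L) := hLim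
    have h2 := ((WeakDual.eval_continuous (𝕜 := ℝ) y).tendsto L).comp h1
    rw [InnerProductSpace.toDual_symm_apply]
    exact h2

/-- The time step. -/
def tau (n : ℕ) : ℝ := 1 / ((n : ℝ) + 1)

/-- The index of the time step containing `t`. -/
def kk (n : ℕ) (t : ℝ) : ℕ := ⌊t * ((n : ℝ) + 1)⌋₊

lemma tau_pos (n : ℕ) : 0 < tau n := Nat.one_div_pos_of_nat

lemma tau_le_one (n : ℕ) : tau n ≤ 1 := by
  rw [tau, div_le_one (by positivity)]
  linarith [(Nat.cast_nonneg n : (0 : ℝ) ≤ n)]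

lemma tendsto_tau : Tendsto tau atTop (nhds 0) := tendsto_one_div_add_atTop_nhds_zero_nat

lemma kk_mono (n : ℕ) : Monotone (kk n) := fun _ _ h =>
  Nat.floor_mono (mul_le_mul_of_nonneg_right h (by positivity))

lemma kk_of_nonpos (n : ℕ) {t : ℝ} (ht : t ≤ 0) : kk n t = 0 :=
  Nat.floor_of_nonpos (mul_nonpos_of_nonpos_of_nonneg ht (by positivity))

lemma tau_mul_kk_le_self (n : ℕ) {t : ℝ} (ht : 0 ≤ t) : tau n * kk n t ≤ t := by
  have h := Nat.floor_le (show 0 ≤ t * ((n : ℝ) + 1) by positivity)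
  rw [tau, kk, one_div, inv_mul_le_iff₀ (by positivity)]
  linarith

lemma tau_mul_kk_le (n : ℕ) {t T : ℝ} (hT : 0 ≤ T) (ht : t ≤ T) : tau n * kk n t ≤ T := by
  rcases le_total 0 t with h | h
  · exact (tau_mul_kk_le_self n h).trans ht
  · rw [kk_of_nonpos n h]
    simpa using hT

lemma sub_tau_le (n : ℕ) (t : ℝ) : t - tau n ≤ tau n * kk n t := by
  have h := Nat.lt_floor_add_one (t * ((n : ℝ) + 1))
  have h2 : t = tau n * (t * ((n : ℝ) + 1)) := by
    rw [tau]; field_simp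
  have h1 := mul_lt_mul_of_pos_left h (tau_pos n)
  rw [← h2] at h1
  change t - tau n ≤ tau n * (⌊t * ((n : ℝ) + 1)⌋₊ : ℝ)
  linarith

lemma tau_mul_kk_sub_le (n : ℕ) {s t : ℝ} (hst : s ≤ t) :
    tau n * ((kk n t : ℝ) - kk n s) ≤ t - s + tau n := by
  rcases le_total 0 t with h | h
  · have := tau_mul_kk_le_self n h
    have := sub_tau_le n s
    linarith
  · rw [kk_of_nonpos n h, kk_of_nonpos n (hst.trans h)]
    have := tau_pos n
    simp
    linarith

lemma tendsto_tau_mul_kk {t : ℝ} (ht : 0 ≤ t) : Tendsto (fun n => tau n * kk n t) atTop (nhds t) := by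
  refine tendsto_of_tendsto_of_tendsto_of_le_of_le (g := fun n => t - tau n) (h := fun _ => t)
    ?_ tendsto_const_nhds (fun n => sub_tau_le n t) (fun n => tau_mul_kk_le_self n ht)
  simpa using tendsto_const_nhds.sub tendsto_tau

/-- A family of discrete trajectories, one for each time step `tau n`. -/
structure Family (F : L2 → L2) (Xbar Vbar : L2) (x v z : ℕ → ℕ → L2) : Prop where
  scheme : ∀ n, Scheme F Xbar Vbar (tau n) (x n) (v n) (z n)
  mem : Xbar ∈ Kcone
  vmem : Vbar ∈ HM Xbar

/-- The discrete time integral of the force. -/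
def SS (z : ℕ → ℕ → L2) (n m : ℕ) : L2 := tau n • ∑ i ∈ Finset.range m, z n i

lemma SS_sub (z : ℕ → ℕ → L2) (n : ℕ) {i j : ℕ} (hij : i ≤ j) :
    SS z n j - SS z n i = tau n • ∑ l ∈ Finset.Ico i j, z n l := by
  rw [SS, SS, ← smul_sub, Finset.sum_Ico_eq_sub _ hij]

namespace Family

variable {F : L2 → L2} {Xbar Vbar : L2} {x v z : ℕ → ℕ → L2}

lemma exists_bound (h : Family F Xbar Vbar x v z) (hF : UnifCont F) (T : ℝ) :
    ∃ B : ℝ, 0 ≤ B ∧ ∀ n k : ℕ, tau n * k ≤ T → ‖x n k‖ ≤ B ∧ ‖v n k‖ ≤ B ∧ ‖z n k‖ ≤ B ∧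
      ‖x n (k + 1) - x n k‖ ≤ tau n * B ∧
        (∑ i ∈ Finset.range k, ‖x n (i + 1) - x n i - tau n • v n (i + 1)‖) ^ 2 ≤ tau n * B := by
  obtain ⟨B, hB, hb⟩ := Scheme.exists_bound hF h.mem Vbar T
  exact ⟨B, hB, fun n k hk => hb _ _ _ _ (tau_pos n) (tau_le_one n) (h.scheme n) k hk⟩

lemma norm_x_sub_le {n : ℕ} {T B : ℝ} (hB : ∀ k : ℕ, tau n * k ≤ T → ‖x n (k + 1) - x n k‖ ≤ tau n * B)
    {i j : ℕ} (hij : i ≤ j) (hj : tau n * j ≤ T) :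
    ‖x n j - x n i‖ ≤ tau n * ((j : ℝ) - i) * B := by
  rw [← Finset.sum_Ico_sub (x n) hij]
  refine (norm_sum_le_of_le (f := fun l => x n (l + 1) - x n l) _ (n := fun _ => tau n * B)
    fun l hl => hB l ?_).trans ?_
  · refine le_trans ?_ hj
    have := tau_pos n
    have : l ≤ j := (Finset.mem_Ico.1 hl).2.le
    gcongr
  · rw [Finset.sum_const, Nat.card_Ico, nsmul_eq_mul, Nat.cast_sub hij]
    exact le_of_eq (by ring)

lemma norm_SS_sub_le {n : ℕ} {T B : ℝ} (hB : ∀ k : ℕ, tau n * k ≤ T → ‖z n k‖ ≤ B)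
    {i j : ℕ} (hij : i ≤ j) (hj : tau n * j ≤ T) :
    ‖SS z n j - SS z n i‖ ≤ tau n * ((j : ℝ) - i) * B := by
  rw [SS_sub z n hij, norm_smul, Real.norm_of_nonneg (tau_pos n).le, mul_assoc]
  refine mul_le_mul_of_nonneg_left ?_ (tau_pos n).le
  refine (norm_sum_le_of_le (f := z n) _ (n := fun _ => B) fun l hl => hB l ?_).trans ?_
  · refine le_trans ?_ hj
    have := tau_pos n
    have : l ≤ j := (Finset.mem_Ico.1 hl).2.le
    gcongr
  · rw [Finset.sum_const, Nat.card_Ico, nsmul_eq_mul, Nat.cast_sub hij]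

/-- The comparison between two averages of the discrete velocities. -/
lemma monotone_inner (h : Family F Xbar Vbar x v z) (n k : ℕ) {Y : L2} (hY : Y ∈ Kcone)
    {j r : ℕ} (hjr : j ≤ r) (hrk : r ≤ k) :
    ⟪v n j - SS z n j, Y - x n k⟫ ≤ ⟪v n r - SS z n r, Y - x n k⟫ := by
  have h1 := (h.scheme n).inner_nonpos (tau_pos n) h.mem h.vmem hjr hrk hY
  rw [← SS_sub z n hjr] at h1
  have h2 : v n j + (SS z n r - SS z n j) - v n r = (v n j - SS z n j) - (v n r - SS z n r) := by abel
  rw [h2, inner_sub_left] at h1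
  linarith

/-- The sum of the discrete quantities is close to its limiting form. -/
lemma abs_sum_sub_le {n : ℕ} {T B : ℝ} (hB0 : 0 ≤ B)
    (hz : ∀ k : ℕ, tau n * k ≤ T → ‖z n k‖ ≤ B)
    (hd : ∀ k : ℕ, tau n * k ≤ T →
      (∑ i ∈ Finset.range k, ‖x n (i + 1) - x n i - tau n • v n (i + 1)‖) ^ 2 ≤ tau n * B)
    {a b : ℕ} (hab : a ≤ b) (hb : tau n * b ≤ T) (D : L2) :
    |tau n * ∑ q ∈ Finset.Ico a b, ⟪v n (q + 1) - SS z n (q + 1), D⟫ -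
      ⟪x n b - x n a - (tau n * ((b : ℝ) - a)) • SS z n a, D⟫| ≤
      (√(tau n * B) + (tau n * ((b : ℝ) - a)) ^ 2 * B) * ‖D‖ := by
  have hτ := tau_pos n
  have e1 : tau n * ∑ q ∈ Finset.Ico a b, ⟪v n (q + 1) - SS z n (q + 1), D⟫ -
      ⟪x n b - x n a - (tau n * ((b : ℝ) - a)) • SS z n a, D⟫ =
      ⟪-(∑ q ∈ Finset.Ico a b, (x n (q + 1) - x n q - tau n • v n (q + 1))) -
        tau n • ∑ q ∈ Finset.Ico a b, (SS z n (q + 1) - SS z n a), D⟫ := by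
    rw [← sum_inner, ← real_inner_smul_left, ← inner_sub_left]
    congr 1
    rw [← Finset.sum_Ico_sub (x n) hab]
    simp only [Finset.sum_sub_distrib]
    rw [← Finset.smul_sum, Finset.sum_const, Nat.card_Ico,
      ← Nat.cast_smul_eq_nsmul ℝ, Nat.cast_sub hab, mul_smul]
    module
  rw [e1]
  refine (abs_real_inner_le_norm _ _).trans (mul_le_mul_of_nonneg_right ?_ (norm_nonneg _))
  refine (norm_sub_le _ _).trans (add_le_add ?_ ?_)
  · rw [norm_neg]
    refine Real.le_sqrt_of_sq_le (le_trans ?_ (hd b hb))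
    refine pow_le_pow_left₀ (norm_nonneg _) ((norm_sum_le _ _).trans ?_) 2
    refine Finset.sum_le_sum_of_subset_of_nonneg (fun i hi => ?_) fun _ _ _ => norm_nonneg _
    exact Finset.mem_range.2 (Finset.mem_Ico.1 hi).2
  · rw [norm_smul, Real.norm_of_nonneg hτ.le]
    have hab' : (a : ℝ) ≤ b := by exact_mod_cast hab
    have : ‖∑ q ∈ Finset.Ico a b, (SS z n (q + 1) - SS z n a)‖ ≤
        ((b : ℝ) - a) * (tau n * ((b : ℝ) - a) * B) := by
      refine (norm_sum_le_of_le (f := fun q => SS z n (q + 1) - SS z n a) _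
        (n := fun _ => tau n * ((b : ℝ) - a) * B) fun q hq => ?_).trans ?_
      · have hq' := Finset.mem_Ico.1 hq
        have hqb : ((q + 1 : ℕ) : ℝ) ≤ b := by exact_mod_cast hq'.2
        have hq1 : tau n * ((q + 1 : ℕ) : ℝ) ≤ T := by
          refine le_trans ?_ hb
          gcongr
        refine (norm_SS_sub_le hz (by omega : a ≤ q + 1) hq1).trans ?_
        gcongr
      · rw [Finset.sum_const, Nat.card_Ico, nsmul_eq_mul, Nat.cast_sub hab]
    calc tau n * ‖∑ q ∈ Finset.Ico a b, (SS z n (q + 1) - SS z n a)‖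
        ≤ tau n * (((b : ℝ) - a) * (tau n * ((b : ℝ) - a) * B)) := by gcongr
      _ = _ := by ring

end Family

/-! ### The limit curve -/

lemma tendsto_inner_of_weak {H ι : Type*} [NormedAddCommGroup H] [InnerProductSpace ℝ H]
    {l : Filter ι} {f g : ι → H} {w y : H} {B : ℝ} (hB : ∀ᶠ i in l, ‖f i‖ ≤ B)
    (hf : ∀ y, Tendsto (fun i => ⟪f i, y⟫) l (nhds ⟪w, y⟫)) (hg : Tendsto g l (nhds y)) :
    Tendsto (fun i => ⟪f i, g i⟫) l (nhds ⟪w, y⟫) := by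
  have h1 : Tendsto (fun i => ⟪f i, g i - y⟫) l (nhds 0) := by
    have h2 : Tendsto (fun i => B * ‖g i - y‖) l (nhds 0) := by
      have := ((hg.sub_const y).norm).const_mul B
      simpa using this
    refine squeeze_zero_norm' ?_ h2
    filter_upwards [hB] with i hi
    rw [Real.norm_eq_abs]
    refine (abs_real_inner_le_norm _ _).trans ?_
    gcongr
  have h3 := (hf y).add h1
  rw [add_zero] at h3
  refine h3.congr fun i => ?_
  rw [← inner_add_right, add_sub_cancel]

/-- `X` and `J` are limits along `U` of the discrete trajectories and of the integrated forces. -/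
structure IsLimit (U : Ultrafilter ℕ) (x z : ℕ → ℕ → L2) (X J : ℝ → L2) : Prop where
  le : (U : Filter ℕ) ≤ atTop
  tendsto_X : ∀ t, Tendsto (fun n => x n (kk n t)) U (nhds (X t))
  tendsto_J : ∀ t y, Tendsto (fun n => ⟪SS z n (kk n t), y⟫) U (nhds ⟪J t, y⟫)

namespace Family

variable {F : L2 → L2} {Xbar Vbar : L2} {x v z : ℕ → ℕ → L2} {U : Ultrafilter ℕ} {X J : ℝ → L2}

lemma exists_norm_SS_le (h : Family F Xbar Vbar x v z) (hF : UnifCont F) (t : ℝ) :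
    ∃ B, ∀ n, ‖SS z n (kk n t)‖ ≤ B := by
  obtain ⟨B, hB0, hB⟩ := h.exists_bound hF (max t 0)
  refine ⟨max t 0 * B, fun n => ?_⟩
  have hk := tau_mul_kk_le n (le_max_right t 0) (le_max_left t 0)
  have := norm_SS_sub_le (fun k hk => (hB n k hk).2.2.1) (Nat.zero_le _) hk
  simp only [SS, Finset.range_zero, Finset.sum_empty, smul_zero, sub_zero, Nat.cast_zero] at this
  exact this.trans (by gcongr)

lemma exists_isLimit {Cp : ℝ} (h : Family F Xbar Vbar x v z) (hp : PtwLinBdd F Cp) (hF : UnifCont F)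
    (hU : (U : Filter ℕ) ≤ atTop) : ∃ X J, IsLimit U x z X J := by
  have h1 : ∀ t, ∃ X, Tendsto (fun n => x n (kk n t)) U (nhds X) := by
    intro t
    obtain ⟨S, hS, hmem⟩ := Scheme.exists_compact hp hF h.mem Vbar (max t 0)
    have hm : ∀ᶠ n in (U : Filter ℕ), x n (kk n t) ∈ S := Eventually.of_forall fun n =>
      hmem _ _ _ _ (tau_pos n) (tau_le_one n) (h.scheme n) _
        (tau_mul_kk_le n (le_max_right t 0) (le_max_left t 0))
    obtain ⟨X, -, hX⟩ := hS.ultrafilter_le_nhds (U.map fun n => x n (kk n t)) (le_principal_iff.2 hm)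
    exact ⟨X, hX⟩
  have h2 : ∀ t, ∃ J, ∀ y, Tendsto (fun n => ⟪SS z n (kk n t), y⟫) U (nhds ⟪J, y⟫) := by
    intro t
    obtain ⟨B, hB⟩ := h.exists_norm_SS_le hF t
    obtain ⟨w, -, hw⟩ := exists_weak_limit U _ (Eventually.of_forall hB)
    exact ⟨w, hw⟩
  choose X hX using h1
  choose J hJ using h2
  exact ⟨X, J, hU, hX, hJ⟩

lemma limit_mem (h : Family F Xbar Vbar x v z) (hL : IsLimit U x z X J) (t : ℝ) : X t ∈ Kcone :=
  Kcone_isClosed.mem_of_tendsto (hL.tendsto_X t) (Eventually.of_forall fun n => (h.scheme n).x_mem h.mem _)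

lemma X_of_nonpos (h : Family F Xbar Vbar x v z) (hL : IsLimit U x z X J) {t : ℝ} (ht : t ≤ 0) :
    X t = Xbar := by
  refine tendsto_nhds_unique (hL.tendsto_X t) ?_
  simp only [kk_of_nonpos _ ht, (h.scheme _).x_zero]
  exact tendsto_const_nhds

lemma J_of_nonpos (hL : IsLimit U x z X J) {t : ℝ} (ht : t ≤ 0) : J t = 0 := by
  refine ext_inner_right ℝ fun y => tendsto_nhds_unique (hL.tendsto_J t y) ?_
  simp only [kk_of_nonpos _ ht, SS, Finset.range_zero, Finset.sum_empty, smul_zero]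
  exact tendsto_const_nhds

lemma exists_lipschitz (h : Family F Xbar Vbar x v z) (hF : UnifCont F) (hL : IsLimit U x z X J) (T : ℝ) :
    ∃ B : ℝ, 0 ≤ B ∧ ∀ s t, s ≤ t → t ≤ T → ‖X t - X s‖ ≤ B * (t - s) ∧ ‖J t - J s‖ ≤ B * (t - s) := by
  obtain ⟨B, hB0, hB⟩ := h.exists_bound hF (max T 0)
  refine ⟨B, hB0, fun s t hst htT => ?_⟩
  have hk : ∀ n, tau n * kk n t ≤ max T 0 := fun n =>
    tau_mul_kk_le n (le_max_right T 0) (htT.trans (le_max_left T 0))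
  have hlim : Tendsto (fun n => (t - s + tau n) * B) U (nhds (B * (t - s))) := by
    have := ((tendsto_tau.const_add (t - s)).mul_const B).mono_left hL.le
    rwa [add_zero, mul_comm] at this
  constructor
  · refine le_of_tendsto_of_tendsto' ((hL.tendsto_X t).sub (hL.tendsto_X s)).norm hlim fun n => ?_
    refine (norm_x_sub_le (fun k hk => (hB n k hk).2.2.2.1) (kk_mono n hst) (hk n)).trans ?_
    have := tau_mul_kk_sub_le n hst
    gcongr
  · have h1 : ∀ y, ⟪J t - J s, y⟫ ≤ B * (t - s) * ‖y‖ := by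
      intro y
      have e := (hL.tendsto_J t y).sub (hL.tendsto_J s y)
      rw [← inner_sub_left] at e
      refine le_of_tendsto_of_tendsto' e (hlim.mul_const ‖y‖) fun n => ?_
      rw [← inner_sub_left]
      refine (real_inner_le_norm _ _).trans (mul_le_mul_of_nonneg_right ?_ (norm_nonneg _))
      refine (norm_SS_sub_le (fun k hk => (hB n k hk).2.2.1) (kk_mono n hst) (hk n)).trans ?_
      have := tau_mul_kk_sub_le n hst
      gcongr
    have h2 := h1 (J t - J s)
    rw [real_inner_self_eq_norm_mul_norm] at h2
    by_contra hcon
    push Not at hcon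
    have : 0 ≤ B * (t - s) := mul_nonneg hB0 (sub_nonneg.2 hst)
    nlinarith

lemma tendsto_increment (h : Family F Xbar Vbar x v z) (hF : UnifCont F) (hL : IsLimit U x z X J)
    {s r t : ℝ} (hs : 0 ≤ s) (hr : 0 ≤ r) (Y : L2) :
    Tendsto (fun n => ⟪x n (kk n r) - x n (kk n s) -
      (tau n * ((kk n r : ℝ) - kk n s)) • SS z n (kk n s), Y - x n (kk n t)⟫) U
      (nhds ⟪X r - X s - (r - s) • J s, Y - X t⟫) := by
  obtain ⟨B, hB⟩ := h.exists_norm_SS_le hF s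
  have hD : Tendsto (fun n => Y - x n (kk n t)) U (nhds (Y - X t)) :=
    tendsto_const_nhds.sub (hL.tendsto_X t)
  have hτ : Tendsto (fun n => tau n * ((kk n r : ℝ) - kk n s)) U (nhds (r - s)) := by
    simp only [mul_sub]
    exact ((tendsto_tau_mul_kk hr).sub (tendsto_tau_mul_kk hs)).mono_left hL.le
  simp only [inner_sub_left (_ - _ : L2), real_inner_smul_left]
  exact (((hL.tendsto_X r).sub (hL.tendsto_X s)).inner hD).sub
    (hτ.mul (tendsto_inner_of_weak (Eventually.of_forall hB) (hL.tendsto_J s) hD))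

/-- The averaged form of the monotonicity of the discrete velocities, in the limit. -/
lemma exists_increment_le (h : Family F Xbar Vbar x v z) (hF : UnifCont F) (hL : IsLimit U x z X J)
    (T : ℝ) : ∃ B : ℝ, 0 ≤ B ∧
      (∀ s a r t Y, 0 ≤ s → 0 < a → s + a ≤ r → r + a ≤ t → t ≤ T → Y ∈ Kcone →
        ⟪X (s + a) - X s - a • J s, Y - X t⟫ ≤
          ⟪X (r + a) - X r - a • J r, Y - X t⟫ + B * a ^ 2 * ‖Y - X t‖) ∧
      ∀ a r t Y, 0 < a → 0 ≤ r → r + a ≤ t → t ≤ T → Y ∈ Kcone →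
        a * ⟪Vbar, Y - X t⟫ ≤ ⟪X (r + a) - X r - a • J r, Y - X t⟫ + B * a ^ 2 * ‖Y - X t‖ := by
  obtain ⟨B, hB0, hB⟩ := h.exists_bound hF (max T 0)
  have hτ : ∀ s a : ℝ, 0 ≤ s → 0 < a →
      Tendsto (fun n => tau n * ((kk n (s + a) : ℝ) - kk n s)) U (nhds a) := by
    intro s a hs ha
    have := ((tendsto_tau_mul_kk (add_nonneg hs ha.le)).sub (tendsto_tau_mul_kk hs)).mono_left hL.le
    simp only [← mul_sub, add_sub_cancel_left] at this
    exact this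
  have hE : ∀ (s a t : ℝ) (Y : L2), 0 ≤ s → 0 < a →
      Tendsto (fun n => (√(tau n * B) + (tau n * ((kk n (s + a) : ℝ) - kk n s)) ^ 2 * B) *
        ‖Y - x n (kk n t)‖) U (nhds (a ^ 2 * B * ‖Y - X t‖)) := by
    intro s a t Y hs ha
    have h1 : Tendsto (fun n => √(tau n * B)) U (nhds 0) := by
      have := (((tendsto_tau.mul_const B).sqrt)).mono_left hL.le
      simpa using this
    have h2 := (h1.add (((hτ s a hs ha).pow 2).mul_const B)).mul
      ((tendsto_const_nhds (x := Y)).sub (hL.tendsto_X t)).norm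
    rwa [zero_add] at h2
  have hkT : ∀ n t, t ≤ T → tau n * kk n t ≤ max T 0 := fun n t ht =>
    tau_mul_kk_le n (le_max_right T 0) (ht.trans (le_max_left T 0))
  have habs := fun n (a b : ℕ) (hab : a ≤ b) hb D => abs_sum_sub_le (x := x) (v := v) (z := z) hB0
    (fun k hk => (hB n k hk).2.2.1) (fun k hk => (hB n k hk).2.2.2.2) hab hb D
  have hdiff : ∀ n s t, s ≤ t → 0 ≤ tau n * ((kk n t : ℝ) - kk n s) := fun n s t hst =>
    mul_nonneg (tau_pos n).le (sub_nonneg.2 (by exact_mod_cast kk_mono n hst))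
  have hlow : ∀ n (r a t : ℝ) Y (j : ℕ), Y ∈ Kcone → 0 < a → r + a ≤ t → j ≤ kk n r →
      tau n * ((kk n (r + a) : ℝ) - kk n r) * ⟪v n j - SS z n j, Y - x n (kk n t)⟫ ≤
      tau n * ∑ q ∈ Finset.Ico (kk n r) (kk n (r + a)),
        ⟪v n (q + 1) - SS z n (q + 1), Y - x n (kk n t)⟫ := by
    intro n r a t Y j hY ha hrt hj
    have := Finset.card_nsmul_le_sum (Finset.Ico (kk n r) (kk n (r + a)))
      (fun q => ⟪v n (q + 1) - SS z n (q + 1), Y - x n (kk n t)⟫)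
      ⟪v n j - SS z n j, Y - x n (kk n t)⟫ fun q hq => by
        have hq' := Finset.mem_Ico.1 hq
        have := kk_mono n hrt
        exact h.monotone_inner n _ hY (by omega) (by omega)
    rw [Nat.card_Ico, nsmul_eq_mul, Nat.cast_sub (kk_mono n (by linarith))] at this
    rw [mul_assoc]
    exact mul_le_mul_of_nonneg_left this (tau_pos n).le
  have hup : ∀ n (s a t : ℝ) Y (j : ℕ), Y ∈ Kcone → 0 < a → kk n (s + a) ≤ j → j ≤ kk n t →
      tau n * ∑ q ∈ Finset.Ico (kk n s) (kk n (s + a)),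
        ⟪v n (q + 1) - SS z n (q + 1), Y - x n (kk n t)⟫ ≤
      tau n * ((kk n (s + a) : ℝ) - kk n s) * ⟪v n j - SS z n j, Y - x n (kk n t)⟫ := by
    intro n s a t Y j hY ha hj hjt
    have := Finset.sum_le_card_nsmul (Finset.Ico (kk n s) (kk n (s + a)))
      (fun q => ⟪v n (q + 1) - SS z n (q + 1), Y - x n (kk n t)⟫)
      ⟪v n j - SS z n j, Y - x n (kk n t)⟫ fun q hq => by
        have hq' := Finset.mem_Ico.1 hq
        exact h.monotone_inner n _ hY (by omega) hjt
    rw [Nat.card_Ico, nsmul_eq_mul, Nat.cast_sub (kk_mono n (by linarith))] at this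
    rw [mul_assoc]
    exact mul_le_mul_of_nonneg_left this (tau_pos n).le
  refine ⟨2 * B, by positivity, ?_, ?_⟩
  · intro s a r t Y hs ha hsr hrt htT hY
    have hr : 0 ≤ r := by linarith
    have l1 := h.tendsto_increment hF hL (t := t) hs (add_nonneg hs ha.le) Y
    have l2 := h.tendsto_increment hF hL (t := t) hr (add_nonneg hr ha.le) Y
    rw [add_sub_cancel_left] at l1 l2
    have key := le_of_tendsto_of_tendsto' ((hτ r a hr ha).mul (l1.sub (hE s a t Y hs ha)))
      ((hτ s a hs ha).mul (l2.add (hE r a t Y hr ha))) fun n => ?_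
    · have := le_of_mul_le_mul_left key ha
      linarith
    · have a1 := (abs_le.1 (habs n _ _ (kk_mono n (by linarith : s ≤ s + a)) (hkT n _ (by linarith))
        (Y - x n (kk n t)))).1
      have a2 := (abs_le.1 (habs n _ _ (kk_mono n (by linarith : r ≤ r + a)) (hkT n _ (by linarith))
        (Y - x n (kk n t)))).2
      have a3 := hup n s a t Y (kk n (s + a)) hY ha le_rfl (kk_mono n (by linarith))
      have a4 := hlow n r a t Y (kk n (s + a)) hY ha hrt (kk_mono n hsr)
      have p1 := hdiff n r (r + a) (by linarith)
      have p2 := hdiff n s (s + a) (by linarith)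
      set g := ⟪v n (kk n (s + a)) - SS z n (kk n (s + a)), Y - x n (kk n t)⟫
      refine (mul_le_mul_of_nonneg_left (show _ ≤ tau n * ((kk n (s + a) : ℝ) - kk n s) * g by
        linarith) p1).trans ?_
      refine le_trans (le_of_eq ?_) (mul_le_mul_of_nonneg_left
        (show tau n * ((kk n (r + a) : ℝ) - kk n r) * g ≤ _ by linarith) p2)
      ring
  · intro a r t Y ha hr hrt htT hY
    have l2 := h.tendsto_increment hF hL (t := t) hr (add_nonneg hr ha.le) Y
    rw [add_sub_cancel_left] at l2
    have l3 : Tendsto (fun n => ⟪Vbar, Y - x n (kk n t)⟫) U (nhds ⟪Vbar, Y - X t⟫) :=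
      tendsto_const_nhds.inner (tendsto_const_nhds.sub (hL.tendsto_X t))
    have key := le_of_tendsto_of_tendsto' ((hτ r a hr ha).mul l3) (l2.add (hE r a t Y hr ha)) fun n => ?_
    · have : 0 ≤ B * a ^ 2 * ‖Y - X t‖ := by positivity
      linarith
    · have a2 := (abs_le.1 (habs n _ _ (kk_mono n (by linarith : r ≤ r + a)) (hkT n _ (by linarith))
        (Y - x n (kk n t)))).2
      have a4 := hlow n r a t Y 0 hY ha hrt (Nat.zero_le _)
      have e : SS z n 0 = 0 := by simp [SS]
      rw [e, sub_zero, (h.scheme n).v_zero] at a4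
      linarith

end Family

/-! ### Composition with Lipschitz functions and subgradients -/

lemma memLp_comp_of_lipschitz {φ : ℝ → ℝ} {k : ℝ≥0} (hφ : LipschitzWith k φ) (W : L2) :
    MemLp (fun m => φ (W m)) 2 mu := by
  have h0 : LipschitzWith k fun y => φ y - φ 0 := by
    simpa using hφ.sub (LipschitzWith.const (φ 0))
  have h1 := (h0.comp_memLp (by simp) (Lp.memLp W)).add (memLp_const (φ 0))
  refine h1.congr_norm (hφ.continuous.comp_aestronglyMeasurable (Lp.aestronglyMeasurable W)) ?_
  exact Eventually.of_forall fun m => by simp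

/-- Composition of an element of `L²(Ω)` with a function, with value `0` when the result is not
square integrable. -/
def compL2 (φ : ℝ → ℝ) (W : L2) : L2 := by
  classical exact if h : MemLp (fun m => φ (W m)) 2 mu then h.toLp else 0

lemma coeFn_compL2 {φ : ℝ → ℝ} {W : L2} (h : MemLp (fun m => φ (W m)) 2 mu) :
    compL2 φ W =ᵐ[mu] fun m => φ (W m) := by
  rw [compL2, dif_pos h]
  exact h.coeFn_toLp

lemma norm_compL2_sub_le {φ : ℝ → ℝ} {k : ℝ≥0} (hφ : LipschitzWith k φ) (W W' : L2) :
    ‖compL2 φ W - compL2 φ W'‖ ≤ k * ‖W - W'‖ := by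
  refine Lp.norm_le_mul_norm_of_ae_le_mul ?_
  filter_upwards [Lp.coeFn_sub (compL2 φ W) (compL2 φ W'), Lp.coeFn_sub W W',
    coeFn_compL2 (memLp_comp_of_lipschitz hφ W), coeFn_compL2 (memLp_comp_of_lipschitz hφ W')]
    with m h1 h2 h3 h4
  rw [h1, h2]
  simp only [Pi.sub_apply, h3, h4]
  have := hφ.dist_le_mul (W m) (W' m)
  simpa [dist_eq_norm] using this

lemma continuous_compL2 {φ : ℝ → ℝ} {k : ℝ≥0} (hφ : LipschitzWith k φ) : Continuous (compL2 φ) :=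
  (LipschitzWith.of_dist_le_mul (K := k) fun W W' => by
    rw [dist_eq_norm, dist_eq_norm]; exact norm_compL2_sub_le hφ W W').continuous

lemma continuous_integral_compL2 {φ : ℝ → ℝ} {k : ℝ≥0} (hφ : LipschitzWith k φ) :
    Continuous fun W => ∫ m, compL2 φ W m ∂mu := by
  have h : ∀ Y : L2, ∫ m, Y m ∂mu = ⟪Y, Lp.const 2 mu (1 : ℝ)⟫ := by
    intro Y
    rw [inner_L2]
    refine integral_congr_ae ?_
    filter_upwards [Lp.coeFn_const (p := 2) (μ := mu) (1 : ℝ)] with m hm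
    rw [hm]
    simp
  simp only [h]
  exact (continuous_compL2 hφ).inner continuous_const

lemma exists_subgradient {ψ : ℝ → ℝ} {k : ℝ≥0} (hc : ConvexOn ℝ univ ψ) (hl : LipschitzWith k ψ) :
    ∃ p : ℝ → ℝ, Measurable p ∧ (∀ y, |p y| ≤ k) ∧ ∀ a b, ψ b + p b * (a - b) ≤ ψ a := by
  set p : ℝ → ℝ := fun x => derivWithin ψ (Ioi x) x with hp
  have hint : ∀ x : ℝ, x ∈ interior (univ : Set ℝ) := by simp
  have hs : ∀ a b, ψ b + p b * (a - b) ≤ ψ a := by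
    intro a b
    rcases lt_trichotomy a b with h | h | h
    · have h1 := hc.slope_le_leftDeriv_of_mem_interior (mem_univ a) (hint b) h
      have h2 := hc.leftDeriv_le_rightDeriv_of_mem_interior (hint b)
      have h3 := h1.trans h2
      rw [slope_def_field, div_le_iff₀ (by linarith)] at h3
      simp only [hp]
      linarith
    · simp [h]
    · have h1 := hc.rightDeriv_le_slope_of_mem_interior (hint b) (mem_univ a) h
      rw [slope_def_field, le_div_iff₀ (by linarith)] at h1
      simp only [hp]
      linarith
  refine ⟨p, ?_, fun y => ?_, hs⟩
  · have := hc.monotoneOn_rightDeriv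
    rw [interior_univ, monotoneOn_univ] at this
    exact this.measurable
  · have h1 := hs (y + 1) y
    have h2 := hs (y - 1) y
    have h3 := hl.dist_le_mul (y + 1) y
    have h4 := hl.dist_le_mul (y - 1) y
    rw [Real.dist_eq, Real.dist_eq] at h3 h4
    have e1 : |y + 1 - y| = 1 := by simp
    have e2 : |y - 1 - y| = 1 := by simp
    rw [e1] at h3
    rw [e2] at h4
    have := (abs_le.1 h3).2
    have := (abs_le.1 h4).2
    rw [abs_le]
    constructor <;> linarith

/-- The subgradient inequality in integrated form. -/
lemma integral_compL2_add_le {ψ p : ℝ → ℝ} {k : ℝ≥0} (hl : LipschitzWith k ψ) (hpm : Measurable p)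
    (hpk : ∀ y, |p y| ≤ k) (hs : ∀ a b, ψ b + p b * (a - b) ≤ ψ a) (A B : L2) :
    ∫ m, compL2 ψ B m ∂mu + (⟪A, compL2 p B⟫ - ⟪B, compL2 p B⟫) ≤ ∫ m, compL2 ψ A m ∂mu := by
  have hpB : MemLp (fun m => p (B m)) 2 mu :=
    memLp_of_bdd (hpm.comp (measurable_L2 B)) (Eventually.of_forall fun m => hpk _)
  rw [← inner_sub_left, inner_L2, ← integral_add (integrable_L2 _)]
  · refine integral_mono_ae ?_ (integrable_L2 _) ?_
    · refine (integrable_L2 _).add ?_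
      exact (L2.integrable_inner (𝕜 := ℝ) (compL2 p B) (A - B)).congr
        (Eventually.of_forall fun m => by simp)
    · filter_upwards [coeFn_compL2 (memLp_comp_of_lipschitz hl A),
        coeFn_compL2 (memLp_comp_of_lipschitz hl B), coeFn_compL2 hpB, Lp.coeFn_sub A B]
        with m h1 h2 h3 h4
      simp only [h1, h2, h3, h4, Pi.sub_apply]
      have := hs (A m) (B m)
      linarith
  · exact (L2.integrable_inner (𝕜 := ℝ) (compL2 p B) (A - B)).congr
      (Eventually.of_forall fun m => by simp)

/-- Jensen's inequality for the projection `EE`. -/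
lemma integral_compL2_EE_le {ψ : ℝ → ℝ} {k : ℝ≥0} (hc : ConvexOn ℝ univ ψ) (hl : LipschitzWith k ψ)
    (X Y : L2) : ∫ m, compL2 ψ (EE X Y) m ∂mu ≤ ∫ m, compL2 ψ Y m ∂mu := by
  obtain ⟨p, hpm, hpk, hs⟩ := exists_subgradient hc hl
  have h := integral_compL2_add_le hl hpm hpk hs Y (EE X Y)
  have hpB : MemLp (fun m => p (EE X Y m)) 2 mu :=
    memLp_of_bdd (hpm.comp (measurable_L2 _)) (Eventually.of_forall fun m => hpk _)
  rw [inner_EE X Y (HM_comp (EE_mem X Y) hpm (coeFn_compL2 hpB))] at h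
  linarith

/-! ### The limiting force -/

lemma continuousOn_of_unifCont {F : L2 → L2} (hF : UnifCont F) : ContinuousOn F Kcone := by
  obtain ⟨-, ω, hω, -, -, hω0, -, hle⟩ := hF
  intro X hX
  rw [ContinuousWithinAt, tendsto_iff_norm_sub_tendsto_zero]
  have h1 : Tendsto (fun Y => ω ‖Y - X‖) (nhdsWithin X Kcone) (nhds 0) := by
    have h2 : Tendsto (fun Y : L2 => ‖Y - X‖) (nhdsWithin X Kcone) (nhdsWithin 0 (Ici 0)) := by
      refine tendsto_nhdsWithin_iff.2 ⟨?_, Eventually.of_forall fun Y => norm_nonneg _⟩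
      have : Tendsto (fun Y : L2 => ‖Y - X‖) (nhds X) (nhds 0) := by
        have h3 : Continuous fun Y : L2 => ‖Y - X‖ := by fun_prop
        simpa using h3.tendsto X
      exact this.mono_left nhdsWithin_le_nhds
    have h4 := (hω 0 self_mem_Ici).tendsto.comp h2
    rwa [hω0] at h4
  refine squeeze_zero' (Eventually.of_forall fun Y => norm_nonneg _) ?_ h1
  filter_upwards [self_mem_nhdsWithin] with Y hY
  exact hle Y hY X hX

namespace Family

variable {F : L2 → L2} {Xbar Vbar : L2} {x v z : ℕ → ℕ → L2} {U : Ultrafilter ℕ} {X J : ℝ → L2}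

lemma inner_deriv_le (h : Family F Xbar Vbar x v z) (hF : UnifCont F) (hL : IsLimit U x z X J) {t : ℝ}
    (ht : 0 ≤ t) {Z : L2} (hZ : HasDerivAt J Z t) {y : L2} {G : L2 → ℝ}
    (hG : ContinuousWithinAt G Kcone (X t)) (hy : ∀ W ∈ Kcone, ⟪EE W (F W), y⟫ ≤ G W) :
    ⟪Z, y⟫ ≤ G (X t) := by
  refine le_of_forall_pos_le_add fun ε hε => ?_
  obtain ⟨η, hη, hηG⟩ := Metric.continuousWithinAt_iff.1 hG ε hε
  obtain ⟨B, hB0, hB⟩ := h.exists_bound hF (t + 1)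
  set δ : ℝ := min 1 (η / (4 * (B + 1))) with hδ
  have hδ0 : 0 < δ := lt_min one_pos (by positivity)
  have hδη : 2 * δ * B < η / 2 := by
    have h1 : δ ≤ η / (4 * (B + 1)) := min_le_right _ _
    rw [le_div_iff₀ (by positivity)] at h1
    nlinarith
  have hinc : ∀ r, 0 < r → r ≤ δ → ⟪J (t + r) - J t, y⟫ ≤ r * (G (X t) + ε) := by
    intro r hr hrδ
    have hmono : ∀ n, kk n t ≤ kk n (t + r) := fun n => kk_mono n (by linarith)
    have hlim : Tendsto (fun n => tau n * ((kk n (t + r) : ℝ) - kk n t) * (G (X t) + ε)) U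
        (nhds (r * (G (X t) + ε))) := by
      have h1 := ((tendsto_tau_mul_kk (by linarith : 0 ≤ t + r)).sub (tendsto_tau_mul_kk ht)).mono_left
        hL.le
      rw [add_sub_cancel_left] at h1
      refine (h1.congr fun n => ?_).mul_const _
      ring
    have hJ : Tendsto (fun n => ⟪SS z n (kk n (t + r)) - SS z n (kk n t), y⟫) U
        (nhds ⟪J (t + r) - J t, y⟫) := by
      simp only [inner_sub_left]
      exact (hL.tendsto_J _ y).sub (hL.tendsto_J _ y)
    refine le_of_tendsto_of_tendsto hJ hlim ?_
    have e1 : ∀ᶠ n in (U : Filter ℕ), dist (x n (kk n t)) (X t) < η / 2 :=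
      (hL.tendsto_X t) (Metric.ball_mem_nhds _ (by positivity))
    have e2 : ∀ᶠ n in (U : Filter ℕ), tau n < δ := hL.le (tendsto_tau.eventually (gt_mem_nhds hδ0))
    filter_upwards [e1, e2] with n hn1 hn2
    have hτ := tau_pos n
    rw [SS_sub z n (hmono n), real_inner_smul_left, sum_inner, mul_assoc]
    refine mul_le_mul_of_nonneg_left ?_ hτ.le
    have hb : ∀ i ∈ Finset.Ico (kk n t) (kk n (t + r)), ⟪z n i, y⟫ ≤ G (X t) + ε := by
      intro i hi
      obtain ⟨hi1, hi2⟩ := Finset.mem_Ico.1 hi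
      have hiT : tau n * i ≤ tau n * kk n (t + r) := by
        have : (i : ℝ) ≤ kk n (t + r) := by exact_mod_cast hi2.le
        gcongr
      have hiT' : tau n * i ≤ t + 1 :=
        hiT.trans (tau_mul_kk_le n (by linarith) (by linarith [min_le_left 1 (η / (4 * (B + 1)))]))
      have h1 := norm_x_sub_le (fun k hk => (hB n k hk).2.2.2.1) hi1 hiT'
      have h2 := tau_mul_kk_sub_le n (by linarith : t ≤ t + r)
      have h3 : tau n * ((i : ℝ) - kk n t) * B ≤ 2 * δ * B := by
        refine mul_le_mul_of_nonneg_right ?_ hB0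
        nlinarith
      have h4 : dist (x n i) (X t) < η := by
        refine (dist_triangle _ (x n (kk n t)) _).trans_lt ?_
        rw [dist_eq_norm (x n i)]
        linarith
      have hK := (h.scheme n).x_mem h.mem i
      have h5 := hηG hK h4
      rw [Real.dist_eq] at h5
      have h6 := hy _ hK
      rw [← (h.scheme n).z_eq] at h6
      linarith [(abs_lt.1 h5).2]
    refine (Finset.sum_le_card_nsmul _ _ _ hb).trans (le_of_eq ?_)
    rw [Nat.card_Ico, nsmul_eq_mul, Nat.cast_sub (hmono n)]
  have hd := hZ.tendsto_slope_zero_right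
  have hd' : Tendsto (fun r : ℝ => ⟪r⁻¹ • (J (t + r) - J t), y⟫) (nhdsWithin 0 (Ioi 0))
      (nhds ⟪Z, y⟫) := hd.inner tendsto_const_nhds
  refine le_of_tendsto hd' ?_
  filter_upwards [Ioc_mem_nhdsGT hδ0] with r hr
  rw [real_inner_smul_left, inv_mul_le_iff₀ hr.1]
  exact hinc r hr.1 hr.2

lemma deriv_sub_mem_HXperp (h : Family F Xbar Vbar x v z) (hF : UnifCont F) (hL : IsLimit U x z X J)
    {t : ℝ} (ht : 0 ≤ t) {Z : L2} (hZ : HasDerivAt J Z t) : Z - F (X t) ∈ HXperp (X t) := by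
  have hK := h.limit_mem hL t
  have hFc := continuousOn_of_unifCont hF (X t) hK
  suffices hs : ∀ U ∈ HM (X t), ⟪Z - F (X t), U⟫ = 0 from fun U hU => hs U (HX_subset_HM hK hU)
  refine orth_HM fun φ hφm ⟨k, hφl⟩ _ Y hY => ?_
  have hYc : Y = compL2 φ (X t) :=
    Lp.ext (hY.trans (coeFn_compL2 (memLp_comp_of_lipschitz hφl _)).symm)
  have key : ∀ s : ℝ, ⟪Z, s • Y⟫ ≤ ⟪F (X t), s • Y⟫ := by
    intro s
    have := h.inner_deriv_le hF hL ht hZ (y := s • Y)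
      (G := fun W => ⟪F W, s • compL2 φ W⟫ + ‖F W‖ * ‖s • Y - s • compL2 φ W‖) ?_ ?_
    · simpa [hYc] using this
    · have hc : ContinuousWithinAt (fun W => s • compL2 φ W) Kcone (X t) :=
        ((continuous_compL2 hφl).const_smul s).continuousWithinAt
      exact (hFc.inner hc).add (hFc.norm.mul (continuousWithinAt_const.sub hc).norm)
    · intro W _
      have h1 : s • compL2 φ W ∈ HM W := (HM W).smul_mem s
        (HM_comp (self_mem_HM W) hφm.measurable (coeFn_compL2 (memLp_comp_of_lipschitz hφl _)))
      have h2 : ⟪EE W (F W), s • Y⟫ = ⟪EE W (F W), s • compL2 φ W⟫ +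
          ⟪EE W (F W), s • Y - s • compL2 φ W⟫ := by
        rw [← inner_add_right, add_sub_cancel]
      rw [h2, inner_EE W (F W) h1]
      have h3 := real_inner_le_norm (EE W (F W)) (s • Y - s • compL2 φ W)
      have h4 := mul_le_mul_of_nonneg_right (norm_EE_le W (F W)) (norm_nonneg (s • Y - s • compL2 φ W))
      linarith
  have k1 := key 1
  have k2 := key (-1)
  simp only [one_smul, neg_smul, inner_neg_right] at k1 k2
  rw [inner_sub_left]
  linarith

lemma integral_compL2_deriv_le (h : Family F Xbar Vbar x v z) (hF : UnifCont F)
    (hL : IsLimit U x z X J) {t : ℝ} (ht : 0 ≤ t) {Z : L2} (hZ : HasDerivAt J Z t)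
    {ψ : ℝ → ℝ} {k : ℝ≥0} (hc : ConvexOn ℝ univ ψ) (hl : LipschitzWith k ψ) :
    ∫ m, compL2 ψ Z m ∂mu ≤ ∫ m, compL2 ψ (F (X t)) m ∂mu := by
  have hFc := continuousOn_of_unifCont hF (X t) (h.limit_mem hL t)
  obtain ⟨p, hpm, hpk, hs⟩ := exists_subgradient hc hl
  have := h.inner_deriv_le hF hL ht hZ (y := compL2 p Z)
    (G := fun W => ∫ m, compL2 ψ (F W) m ∂mu - ∫ m, compL2 ψ Z m ∂mu + ⟪Z, compL2 p Z⟫) ?_ ?_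
  · linarith
  · have hc1 : ContinuousWithinAt (fun W => ∫ m, compL2 ψ (F W) m ∂mu) Kcone (X t) :=
      (continuous_integral_compL2 hl).continuousAt.comp_continuousWithinAt hFc
    exact (hc1.sub continuousWithinAt_const).add continuousWithinAt_const
  · intro W _
    have h1 := integral_compL2_add_le hl hpm hpk hs (EE W (F W)) Z
    have h2 := integral_compL2_EE_le hc hl W (F W)
    linarith

end Family

/-! ### Domination and Lipschitz regularization of convex functions -/

/-- The Lipschitz regularization of `φ` by infimal convolution. -/
def lipReg (φ : ℝ → ℝ≥0∞) (k : ℕ) (x : ℝ) : ℝ≥0∞ := ⨅ y, φ y + k * edist x y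

lemma lipReg_le (φ : ℝ → ℝ≥0∞) (k : ℕ) (x y : ℝ) : lipReg φ k x ≤ φ y + k * edist x y :=
  iInf_le _ y

lemma lipReg_le_self (φ : ℝ → ℝ≥0∞) (k : ℕ) (x : ℝ) : lipReg φ k x ≤ φ x := by
  simpa using lipReg_le φ k x x

lemma lipReg_ne_top {φ : ℝ → ℝ≥0∞} {y : ℝ} (hy : φ y ≠ ⊤) (k : ℕ) (x : ℝ) : lipReg φ k x ≠ ⊤ := by
  refine ne_top_of_le_ne_top ?_ (lipReg_le φ k x y)
  exact ENNReal.add_ne_top.2 ⟨hy, ENNReal.mul_ne_top (by simp) (edist_ne_top _ _)⟩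

lemma lipReg_monotone (φ : ℝ → ℝ≥0∞) : Monotone (lipReg φ) := by
  intro k l hkl x
  refine iInf_mono fun y => ?_
  gcongr

lemma iSup_lipReg {φ : ℝ → ℝ≥0∞} (hφ : LowerSemicontinuous φ) (x : ℝ) : ⨆ k, lipReg φ k x = φ x := by
  refine le_antisymm (iSup_le fun k => lipReg_le_self φ k x) (le_of_forall_lt fun a ha => ?_)
  obtain ⟨b, hab, hb⟩ := exists_between ha
  obtain ⟨r, hr, hball⟩ := EMetric.mem_nhds_iff.1 (hφ x b hb)
  have hbt : b ≠ ⊤ := hb.ne_top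
  by_cases hrt : r = ⊤
  · refine lt_of_lt_of_le hab (le_iSup_of_le 0 (le_iInf fun y => ?_))
    have : b < φ y := hball (by simp [hrt])
    exact this.le.trans le_self_add
  obtain ⟨k, hk⟩ := ENNReal.exists_nat_gt (ENNReal.div_lt_top hbt hr.ne').ne
  refine lt_of_lt_of_le hab (le_iSup_of_le k (le_iInf fun y => ?_))
  by_cases hy : y ∈ Metric.eball x r
  · exact (hball hy).le.trans le_self_add
  · rw [Metric.mem_eball, not_lt, edist_comm] at hy
    refine le_trans ?_ le_add_self
    rw [ENNReal.div_lt_iff (Or.inl hr.ne') (Or.inl hrt)] at hk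
    exact hk.le.trans (by gcongr)

lemma lipReg_lipschitz {φ : ℝ → ℝ≥0∞} {y : ℝ} (hy : φ y ≠ ⊤) (k : ℕ) :
    LipschitzWith k fun x => (lipReg φ k x).toReal := by
  refine LipschitzWith.of_le_add_mul _ fun a b => ?_
  have h1 : lipReg φ k a ≤ lipReg φ k b + k * edist a b := by
    conv_rhs => rw [lipReg]
    rw [ENNReal.iInf_add]
    refine le_iInf fun c => (lipReg_le φ k a c).trans ?_
    have := edist_triangle a b c
    calc φ c + k * edist a c ≤ φ c + k * (edist a b + edist b c) := by gcongr
      _ = φ c + k * edist b c + k * edist a b := by ring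
  have hk : (k : ℝ≥0∞) * edist a b ≠ ⊤ := ENNReal.mul_ne_top (by simp) (edist_ne_top _ _)
  have h2 := ENNReal.toReal_mono (ENNReal.add_ne_top.2 ⟨lipReg_ne_top hy k b, hk⟩) h1
  rw [ENNReal.toReal_add (lipReg_ne_top hy k b) hk, ENNReal.toReal_mul, ENNReal.toReal_natCast,
    edist_dist, ENNReal.toReal_ofReal dist_nonneg] at h2
  simpa using h2

lemma lipReg_convex {φ : ℝ → ℝ≥0∞} {y : ℝ} (hy : φ y ≠ ⊤)
    (hφ : ∀ x y : ℝ, ∀ a b : ℝ≥0, a + b = 1 →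
      φ ((a : ℝ) * x + (b : ℝ) * y) ≤ (a : ℝ≥0∞) * φ x + (b : ℝ≥0∞) * φ y) (k : ℕ) :
    ConvexOn ℝ univ fun x => (lipReg φ k x).toReal := by
  refine ⟨convex_univ, fun x₁ _ x₂ _ a b ha hb hab => ?_⟩
  lift a to ℝ≥0 using ha
  lift b to ℝ≥0 using hb
  have hab' : a + b = 1 := by exact_mod_cast hab
  have h1 : lipReg φ k ((a : ℝ) * x₁ + (b : ℝ) * x₂) ≤
      (a : ℝ≥0∞) * lipReg φ k x₁ + (b : ℝ≥0∞) * lipReg φ k x₂ := by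
    refine ENNReal.le_of_forall_pos_le_add fun ε hε _ => ?_
    have hex : ∀ x, ∃ c, φ c + k * edist x c < lipReg φ k x + ε := fun x =>
      iInf_lt_iff.1 (ENNReal.lt_add_right (lipReg_ne_top hy k x) (by exact_mod_cast hε.ne'))
    obtain ⟨c₁, hc₁⟩ := hex x₁
    obtain ⟨c₂, hc₂⟩ := hex x₂
    have hd : edist ((a : ℝ) * x₁ + (b : ℝ) * x₂) ((a : ℝ) * c₁ + (b : ℝ) * c₂) ≤
        (a : ℝ≥0∞) * edist x₁ c₁ + (b : ℝ≥0∞) * edist x₂ c₂ := by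
      refine (edist_add_add_le _ _ _ _).trans (le_of_eq ?_)
      have := edist_smul₀ (a : ℝ) x₁ c₁
      have := edist_smul₀ (b : ℝ) x₂ c₂
      simp_all [ENNReal.smul_def]
    calc lipReg φ k ((a : ℝ) * x₁ + (b : ℝ) * x₂)
        ≤ _ := lipReg_le φ k _ ((a : ℝ) * c₁ + (b : ℝ) * c₂)
      _ ≤ ((a : ℝ≥0∞) * φ c₁ + (b : ℝ≥0∞) * φ c₂) +
          k * ((a : ℝ≥0∞) * edist x₁ c₁ + (b : ℝ≥0∞) * edist x₂ c₂) := by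
        gcongr
        exact hφ _ _ _ _ hab'
      _ = (a : ℝ≥0∞) * (φ c₁ + k * edist x₁ c₁) + (b : ℝ≥0∞) * (φ c₂ + k * edist x₂ c₂) := by ring
      _ ≤ (a : ℝ≥0∞) * (lipReg φ k x₁ + ε) + (b : ℝ≥0∞) * (lipReg φ k x₂ + ε) := by
        gcongr
      _ = (a : ℝ≥0∞) * lipReg φ k x₁ + (b : ℝ≥0∞) * lipReg φ k x₂ + ((a + b : ℝ≥0) : ℝ≥0∞) * ε := by
        push_cast
        ring
      _ = _ := by rw [hab', ENNReal.coe_one, one_mul]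
  have hf : ∀ (a : ℝ≥0) x, (a : ℝ≥0∞) * lipReg φ k x ≠ ⊤ := fun a x =>
    ENNReal.mul_ne_top ENNReal.coe_ne_top (lipReg_ne_top hy k x)
  have h2 := ENNReal.toReal_mono (ENNReal.add_ne_top.2 ⟨hf a x₁, hf b x₂⟩) h1
  rw [ENNReal.toReal_add (hf a x₁) (hf b x₂), ENNReal.toReal_mul, ENNReal.toReal_mul] at h2
  simpa using h2

lemma dominated_of_lipschitz {Z Y : L2}
    (h : ∀ (ψ : ℝ → ℝ) (k : ℝ≥0), ConvexOn ℝ univ ψ → LipschitzWith k ψ →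
      ∫ m, compL2 ψ Z m ∂mu ≤ ∫ m, compL2 ψ Y m ∂mu) : Dominated Z Y := by
  intro φ hlsc hconv
  by_cases hex : ∃ y, φ y ≠ ⊤
  swap
  · push Not at hex
    simp [hex]
  obtain ⟨y, hy⟩ := hex
  have hint : ∀ (k : ℕ) (W : L2), ∫⁻ m, lipReg φ k (W m) ∂mu =
      ENNReal.ofReal (∫ m, compL2 (fun x => (lipReg φ k x).toReal) W m ∂mu) := by
    intro k W
    have hae := coeFn_compL2 (φ := fun x => (lipReg φ k x).toReal)
      (memLp_comp_of_lipschitz (lipReg_lipschitz hy k) W)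
    rw [ofReal_integral_eq_lintegral_ofReal (integrable_L2 _)]
    · refine lintegral_congr_ae ?_
      filter_upwards [hae] with m hm
      rw [hm, ENNReal.ofReal_toReal (lipReg_ne_top hy k _)]
    · filter_upwards [hae] with m hm
      rw [hm]
      exact ENNReal.toReal_nonneg
  have hmeas : ∀ k, Measurable (lipReg φ k) := by
    intro k
    have h1 := (lipReg_lipschitz hy k).continuous.measurable.ennreal_ofReal
    simpa only [ENNReal.ofReal_toReal (lipReg_ne_top hy k _)] using h1
  have hsup : ∫⁻ m, φ (Z m) ∂mu = ⨆ k, ∫⁻ m, lipReg φ k (Z m) ∂mu := by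
    rw [← lintegral_iSup (f := fun k m => lipReg φ k (Z m)) (fun k => (hmeas k).comp (measurable_L2 Z))
      (fun k l hkl m => lipReg_monotone φ hkl _)]
    simp only [iSup_lipReg hlsc]
  rw [hsup]
  refine iSup_le fun k => ?_
  calc ∫⁻ m, lipReg φ k (Z m) ∂mu ≤ ∫⁻ m, lipReg φ k (Y m) ∂mu := by
        rw [hint, hint]
        exact ENNReal.ofReal_le_ofReal (h _ _ (lipReg_convex hy hconv k) (lipReg_lipschitz hy k))
    _ ≤ _ := lintegral_mono fun m => lipReg_le_self φ k _

/-! ### Differentiability of Lipschitz curves in a Hilbert space -/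

section LipschitzCurve

variable {H : Type*} [NormedAddCommGroup H] [InnerProductSpace ℝ H] [CompleteSpace H]

lemma exists_density_of_lipschitz {f : ℝ → H} {K : ℝ≥0} (hf : LipschitzWith K f) {a b : ℝ} (hab : a ≤ b) :
    ∃ w : ℝ → H, IntervalIntegrable w volume a b ∧ ∀ c ∈ Icc a b, ∫ s in a..c, w s = f c - f a := by
  set μ : Measure ℝ := volume.restrict (Ioc a b) with hμ
  have hfc := hf.continuous
  set g : ℕ → ℝ → H := fun n s => (tau n)⁻¹ • (f (s + tau n) - f s) with hg
  have hgc : ∀ n, Continuous (g n) := fun n => by fun_prop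
  have hgb : ∀ n s, ‖g n s‖ ≤ K := by
    intro n s
    have h1 := hf.norm_sub_le (s + tau n) s
    rw [add_sub_cancel_left, Real.norm_of_nonneg (tau_pos n).le] at h1
    rw [hg, norm_smul, norm_inv, Real.norm_of_nonneg (tau_pos n).le, inv_mul_le_iff₀ (tau_pos n)]
    linarith
  have hgL : ∀ n, MemLp (g n) 2 μ := fun n =>
    MemLp.of_bound (hgc n).aestronglyMeasurable K (Eventually.of_forall (hgb n))
  obtain ⟨C, hC⟩ : ∃ C, ∀ n, ‖(hgL n).toLp‖ ≤ C :=
    ⟨_, fun n => Lp.norm_le_of_ae_bound K.2 (by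
      filter_upwards [(hgL n).coeFn_toLp] with s hs
      rw [hs]
      exact hgb n s)⟩
  set U : Ultrafilter ℕ := Ultrafilter.of atTop with hU
  have hUle : (U : Filter ℕ) ≤ atTop := Ultrafilter.of_le atTop
  obtain ⟨w, -, hw⟩ := exists_weak_limit U (fun n => (hgL n).toLp) (Eventually.of_forall hC)
  have hwi : IntegrableOn w (Ioc a b) := (Lp.memLp w).integrable one_le_two
  refine ⟨w, (intervalIntegrable_iff_integrableOn_Ioc_of_le hab).2 hwi, fun c hc => ?_⟩
  set Φ : ℝ → H := fun x => ∫ s in (0 : ℝ)..x, f s with hΦ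
  have hΦd : ∀ x, Tendsto (fun n => (tau n)⁻¹ • (Φ (x + tau n) - Φ x)) atTop (nhds (f x)) := by
    intro x
    have h1 : HasDerivAt Φ (f x) x := (hfc.integral_hasStrictDerivAt 0 x).hasDerivAt
    refine h1.tendsto_slope_zero_right.comp (tendsto_nhdsWithin_iff.2 ⟨tendsto_tau, ?_⟩)
    exact Eventually.of_forall tau_pos
  have hint : ∀ n, ∫ s in a..c, g n s =
      (tau n)⁻¹ • (Φ (c + tau n) - Φ c) - (tau n)⁻¹ • (Φ (a + tau n) - Φ a) := by
    intro n
    have hi : ∀ x y : ℝ, IntervalIntegrable f volume x y := fun x y => hfc.intervalIntegrable x y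
    simp only [hg]
    have hi' : IntervalIntegrable (fun s => f (s + tau n)) volume a c :=
      (hfc.comp (continuous_id.add continuous_const)).intervalIntegrable _ _
    rw [intervalIntegral.integral_smul, intervalIntegral.integral_sub hi' (hi _ _),
      intervalIntegral.integral_comp_add_right, ← smul_sub,
      ← intervalIntegral.integral_interval_sub_left (hi 0 (c + tau n)) (hi 0 (a + tau n)),
      ← intervalIntegral.integral_interval_sub_left (hi 0 c) (hi 0 a)]
    congr 1
    simp only [hΦ]
    abel
  have hsub : Ioc a c ⊆ Ioc a b := Ioc_subset_Ioc_right hc.2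
  have hμc : μ (Ioc a c) ≠ ⊤ := measure_ne_top _ _
  have hset : ∀ (u : ℝ → H), ∫ s in Ioc a c, u s ∂μ = ∫ s in a..c, u s := by
    intro u
    rw [hμ, Measure.restrict_restrict measurableSet_Ioc, inter_eq_left.2 hsub,
      intervalIntegral.integral_of_le hc.1]
  refine ext_inner_left ℝ fun e => ?_
  have h1 := hw (indicatorConstLp 2 measurableSet_Ioc hμc e)
  have h2 : ∀ u : Lp H 2 μ, ⟪u, indicatorConstLp 2 measurableSet_Ioc hμc e⟫ =
      ⟪e, ∫ s in Ioc a c, u s ∂μ⟫ := fun u => by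
    rw [real_inner_comm, L2.inner_indicatorConstLp_eq_inner_setIntegral]
  simp only [h2, hset] at h1
  have h3 : ∀ n, ∫ s in a..c, ((hgL n).toLp (g n) : ℝ → H) s = ∫ s in a..c, g n s := by
    intro n
    rw [← hset, ← hset]
    exact integral_congr_ae (ae_restrict_of_ae (hgL n).coeFn_toLp)
  simp only [h3, hint] at h1
  have h4 : Tendsto (fun n => ⟪e, (tau n)⁻¹ • (Φ (c + tau n) - Φ c) -
      (tau n)⁻¹ • (Φ (a + tau n) - Φ a)⟫) U (nhds ⟪e, f c - f a⟫) :=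
    (tendsto_const_nhds.inner ((hΦd c).sub (hΦd a))).mono_left hUle
  exact tendsto_nhds_unique h1 h4

lemma ae_hasDerivAt_of_lipschitz {f : ℝ → H} {K : ℝ≥0} (hf : LipschitzWith K f) {a b : ℝ} (hab : a ≤ b) :
    (∀ᵐ t, t ∈ Ioo a b → HasDerivAt f (deriv f t) t) ∧ ∫ s in a..b, deriv f s = f b - f a := by
  obtain ⟨w, hwi, hw⟩ := exists_density_of_lipschitz hf hab
  have hd : ∀ᵐ t, t ∈ Ioo a b → HasDerivAt f (w t) t := by
    filter_upwards [hwi.ae_hasDerivAt_integral] with t ht htab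
    rw [uIcc_of_le hab] at ht
    have h1 := (ht (Ioo_subset_Icc_self htab) a (left_mem_Icc.2 hab)).const_add (f a)
    refine h1.congr_of_eventuallyEq ?_
    filter_upwards [Ioo_mem_nhds htab.1 htab.2] with s hs
    rw [hw s (Ioo_subset_Icc_self hs)]
    abel
  refine ⟨hd.mono fun t ht htab => (ht htab).differentiableAt.hasDerivAt, ?_⟩
  rw [← hw b (right_mem_Icc.2 hab)]
  refine intervalIntegral.integral_congr_ae ?_
  have hb : ∀ᵐ t : ℝ, t ≠ b := by simp [ae_iff, measure_singleton]
  filter_upwards [hd, hb] with t ht htb htab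
  rw [uIoc_of_le hab] at htab
  exact (ht ⟨htab.1, lt_of_le_of_ne htab.2 htb⟩).deriv

end LipschitzCurve

section LocallyLipschitzCurve

lemma exists_norm_deriv_le {E : Type*} [NormedAddCommGroup E] [NormedSpace ℝ E] {f : ℝ → E}
    (hf : ∀ T, ∃ K : ℝ≥0, LipschitzOnWith K f (Iic T))
    (T : ℝ) : ∃ K : ℝ, 0 ≤ K ∧ ∀ t ≤ T, ‖deriv f t‖ ≤ K := by
  obtain ⟨K, hK⟩ := hf (T + 1)
  exact ⟨K, K.2, fun t ht => norm_deriv_le_of_lipschitzOn (Iic_mem_nhds (by linarith)) hK⟩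

lemma continuous_of_lipschitzOn {E : Type*} [PseudoMetricSpace E] {f : ℝ → E}
    (hf : ∀ T, ∃ K : ℝ≥0, LipschitzOnWith K f (Iic T)) :
    Continuous f := by
  refine continuous_iff_continuousAt.2 fun t => ?_
  obtain ⟨K, hK⟩ := hf (t + 1)
  exact hK.continuousOn.continuousAt (Iic_mem_nhds (by linarith))

variable {H : Type*} [NormedAddCommGroup H] [InnerProductSpace ℝ H] [CompleteSpace H]

lemma ae_hasDerivAt_of_lipschitzOn {f : ℝ → H} {K : ℝ≥0} {a b : ℝ} (hab : a ≤ b)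
    (hf : LipschitzOnWith K f (Icc a b)) :
    (∀ᵐ t, t ∈ Ioo a b → HasDerivAt f (deriv f t) t) ∧ ∫ s in a..b, deriv f s = f b - f a := by
  set g : ℝ → H := fun t => f (projIcc a b hab t) with hg
  have hgl : LipschitzWith K g := by
    intro s t
    refine (hf (projIcc a b hab s).2 (projIcc a b hab t).2).trans ?_
    have := (LipschitzWith.projIcc hab).edist_le_mul s t
    rw [ENNReal.coe_one, one_mul] at this
    gcongr
    exact this
  have hgf : ∀ t ∈ Icc a b, g t = f t := fun t ht => by rw [hg]; simp only [projIcc_of_mem hab ht]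
  have he : ∀ t ∈ Ioo a b, g =ᶠ[nhds t] f := fun t ht =>
    Filter.eventuallyEq_of_mem (Icc_mem_nhds ht.1 ht.2) hgf
  obtain ⟨h1, h2⟩ := ae_hasDerivAt_of_lipschitz hgl hab
  refine ⟨h1.mono fun t ht htab => ?_, ?_⟩
  · exact ((ht htab).congr_of_eventuallyEq (he t htab).symm).differentiableAt.hasDerivAt
  · rw [← hgf a (left_mem_Icc.2 hab), ← hgf b (right_mem_Icc.2 hab), ← h2]
    refine intervalIntegral.integral_congr_ae ?_
    have hb : ∀ᵐ t : ℝ, t ≠ b := by simp [ae_iff, measure_singleton]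
    filter_upwards [hb] with t htb htab
    rw [uIoc_of_le hab] at htab
    exact ((he t ⟨htab.1, lt_of_le_of_ne htab.2 htb⟩).deriv_eq).symm

variable {f : ℝ → H}


lemma ae_hasDerivAt (hf : ∀ T, ∃ K : ℝ≥0, LipschitzOnWith K f (Iic T)) :
    ∀ᵐ t, HasDerivAt f (deriv f t) t := by
  have h : ∀ n : ℕ, ∀ᵐ t, t ∈ Ioo (-(n : ℝ)) n → HasDerivAt f (deriv f t) t := by
    intro n
    obtain ⟨K, hK⟩ := hf n
    exact (ae_hasDerivAt_of_lipschitzOn (by linarith [(Nat.cast_nonneg n : (0 : ℝ) ≤ n)])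
      (hK.mono Icc_subset_Iic_self)).1
  filter_upwards [ae_all_iff.2 h] with t ht
  obtain ⟨n, hn⟩ := exists_nat_gt |t|
  exact ht n (abs_lt.1 hn)

lemma integral_deriv_eq (hf : ∀ T, ∃ K : ℝ≥0, LipschitzOnWith K f (Iic T))
    {a b : ℝ} (hab : a ≤ b) : ∫ s in Ioc a b, deriv f s = f b - f a := by
  obtain ⟨K, hK⟩ := hf b
  rw [← intervalIntegral.integral_of_le hab]
  exact (ae_hasDerivAt_of_lipschitzOn hab (hK.mono Icc_subset_Iic_self)).2

lemma intervalIntegrable_deriv (hf : ∀ T, ∃ K : ℝ≥0, LipschitzOnWith K f (Iic T))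
    (a b : ℝ) : IntervalIntegrable (deriv f) volume a b := by
  obtain ⟨K, -, hK⟩ := exists_norm_deriv_le hf (max a b)
  refine intervalIntegrable_const (c := K) |>.mono_fun (aestronglyMeasurable_deriv f _) ?_
  filter_upwards [ae_restrict_mem measurableSet_uIoc] with t ht
  exact (hK t ht.2).trans (le_abs_self K)

/-- Integration by parts against the weight `t - s`. -/
lemma integral_weight_deriv (hf : ∀ T, ∃ K : ℝ≥0, LipschitzOnWith K f (Iic T))
    {a t : ℝ} (hat : a ≤ t) :
    ∫ s in Ioc a t, (t - s) • deriv f s = ∫ s in Ioc a t, (f s - f a) := by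
  obtain ⟨K, hK⟩ := hf t
  have hc := continuous_of_lipschitzOn hf
  set g : ℝ → H := fun s => (t - s) • (f s - f a) with hg
  have hgl : LipschitzOnWith (K * (t - a).toNNReal + K * (t - a).toNNReal) g (Icc a t) := by
    refine LipschitzOnWith.of_dist_le_mul fun r hr s hs => ?_
    have e : g r - g s = (t - r) • (f r - f s) + (s - r) • (f s - f a) := by
      simp only [hg]
      module
    have h1 := hK.dist_le_mul r hr.2 s hs.2
    have h2 := hK.dist_le_mul s hs.2 a hat
    rw [dist_eq_norm, Real.dist_eq] at h1 h2
    rw [dist_eq_norm, e, Real.dist_eq]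
    refine (norm_add_le _ _).trans ?_
    rw [norm_smul, norm_smul, Real.norm_eq_abs, Real.norm_eq_abs]
    push_cast
    rw [Real.coe_toNNReal _ (sub_nonneg.2 hat), add_mul, abs_sub_comm s r,
      abs_of_nonneg (sub_nonneg.2 hr.2)]
    rw [abs_of_nonneg (sub_nonneg.2 hs.1)] at h2
    have h3 : t - r ≤ t - a := by linarith [hr.1]
    have h4 : K * (s - a) ≤ K * (t - a) := by gcongr; exact hs.2
    have h5 : (t - r) * ‖f r - f s‖ ≤ (t - a) * (K * |r - s|) := by gcongr
    have h6 : |r - s| * ‖f s - f a‖ ≤ |r - s| * (K * (t - a)) := by gcongr; exact h2.trans h4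
    linarith
  have h1 := (ae_hasDerivAt_of_lipschitzOn hat hgl).2
  rw [intervalIntegral.integral_of_le hat] at h1
  have e0 : g t - g a = 0 := by simp [hg]
  have hi1 : IntegrableOn (fun s => (t - s) • deriv f s) (Ioc a t) := by
    have := (intervalIntegrable_deriv hf a t).continuousOn_smul (f := fun s => t - s)
      (by fun_prop)
    exact (intervalIntegrable_iff_integrableOn_Ioc_of_le hat).1 this
  have hi2 : IntegrableOn (fun s => f s - f a) (Ioc a t) :=
    ((hc.sub continuous_const).integrableOn_Icc).mono_set Ioc_subset_Icc_self
  rw [e0] at h1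
  rw [← sub_eq_zero, ← integral_sub hi1 hi2, ← h1]
  refine integral_congr_ae (ae_restrict_of_ae ?_)
  filter_upwards [ae_hasDerivAt hf] with s hs
  have h2 : HasDerivAt g ((t - s) • deriv f s + (-1 : ℝ) • (f s - f a)) s :=
    ((hasDerivAt_id s).const_sub t).smul (hs.sub_const (f a))
  rw [h2.deriv]
  module

end LocallyLipschitzCurve

/-! ### Curves with monotone velocity inequality -/

lemma tendsto_slope_right {E : Type*} [NormedAddCommGroup E] [NormedSpace ℝ E] {f : ℝ → E} {f' : E} {x : ℝ}
    (h : HasDerivWithinAt f f' (Ici x) x) :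
    Tendsto (fun a => a⁻¹ • (f (x + a) - f x)) (nhdsWithin 0 (Ioi 0)) (nhds f') := by
  have h1 := (hasDerivWithinAt_iff_tendsto_slope' self_notMem_Ioi).1 h.Ioi_of_Ici
  have h2 : Tendsto (fun a => x + a) (nhdsWithin 0 (Ioi 0)) (nhdsWithin x (Ioi x)) := by
    refine tendsto_nhdsWithin_iff.2 ⟨?_, ?_⟩
    · have : Tendsto (fun a => x + a) (nhds 0) (nhds x) := by
        simpa using (continuous_const.add continuous_id).tendsto (f := fun a => x + a) (0 : ℝ)
      exact this.mono_left nhdsWithin_le_nhds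
    · filter_upwards [self_mem_nhdsWithin] with a ha
      simpa using ha
  refine (h1.comp h2).congr fun a => ?_
  simp [slope]

/-- A locally Lipschitz curve in the cone whose difference quotients, corrected by the
integrated force, satisfy an approximate monotonicity property. -/
structure MonoCurve (Vbar : L2) (X J : ℝ → L2) : Prop where
  mem : ∀ t, X t ∈ Kcone
  J_zero : J 0 = 0
  lip_X : ∀ T, ∃ K : ℝ≥0, LipschitzOnWith K X (Iic T)
  lip_J : ∀ T, ∃ K : ℝ≥0, LipschitzOnWith K J (Iic T)
  incr : ∀ T, ∃ B : ℝ, 0 ≤ B ∧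
    (∀ s a r t Y, 0 ≤ s → 0 < a → s + a ≤ r → r + a ≤ t → t ≤ T → Y ∈ Kcone →
      ⟪X (s + a) - X s - a • J s, Y - X t⟫ ≤
        ⟪X (r + a) - X r - a • J r, Y - X t⟫ + B * a ^ 2 * ‖Y - X t‖) ∧
    ∀ a r t Y, 0 < a → 0 ≤ r → r + a ≤ t → t ≤ T → Y ∈ Kcone →
      a * ⟪Vbar, Y - X t⟫ ≤ ⟪X (r + a) - X r - a • J r, Y - X t⟫ + B * a ^ 2 * ‖Y - X t‖

namespace MonoCurve

variable {Vbar : L2} {X J : ℝ → L2}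

lemma tendsto_inner_slope {r : ℝ} {w : L2} (hw : HasDerivWithinAt X w (Ici r) r) (D : L2) :
    Tendsto (fun a => a⁻¹ * ⟪X (r + a) - X r - a • J r, D⟫) (nhdsWithin 0 (Ioi 0))
      (nhds ⟪w - J r, D⟫) := by
  have h1 : Tendsto (fun a => ⟪a⁻¹ • (X (r + a) - X r) - J r, D⟫) (nhdsWithin 0 (Ioi 0))
      (nhds ⟪w - J r, D⟫) :=
    ((tendsto_slope_right hw).sub_const (J r)).inner tendsto_const_nhds
  refine h1.congr' ?_
  filter_upwards [self_mem_nhdsWithin] with a ha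
  rw [← real_inner_smul_left, smul_sub _ _ (a • J r), inv_smul_smul₀ (ne_of_gt ha)]

lemma tendsto_inner_slope_add {r : ℝ} {w : L2} (hw : HasDerivWithinAt X w (Ici r) r) (D : L2) (B : ℝ) :
    Tendsto (fun a => a⁻¹ * (⟪X (r + a) - X r - a • J r, D⟫ + B * a ^ 2 * ‖D‖))
      (nhdsWithin 0 (Ioi 0)) (nhds ⟪w - J r, D⟫) := by
  have h0 : Tendsto (fun a : ℝ => B * a * ‖D‖) (nhdsWithin 0 (Ioi 0)) (nhds 0) := by
    have : Tendsto (fun a : ℝ => B * a * ‖D‖) (nhds 0) (nhds (B * 0 * ‖D‖)) :=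
      (by fun_prop : Continuous fun a : ℝ => B * a * ‖D‖).tendsto 0
    rw [mul_zero, zero_mul] at this
    exact this.mono_left nhdsWithin_le_nhds
  have h1 := (tendsto_inner_slope (J := J) hw D).add h0
  rw [add_zero] at h1
  refine h1.congr' ?_
  filter_upwards [self_mem_nhdsWithin] with a ha
  have : a ≠ 0 := ne_of_gt ha
  field_simp

lemma continuous_X (h : MonoCurve Vbar X J) : Continuous X := continuous_of_lipschitzOn h.lip_X

lemma continuous_J (h : MonoCurve Vbar X J) : Continuous J := continuous_of_lipschitzOn h.lip_J

lemma inner_le_of_forall_gt (h : MonoCurve Vbar X J) {u w Y : L2} {t : ℝ}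
    (hlt : ∀ t', t < t' → ⟪u, Y - X t'⟫ ≤ ⟪w, Y - X t'⟫) : ⟪u, Y - X t⟫ ≤ ⟪w, Y - X t⟫ := by
  have hc : ∀ u : L2, Tendsto (fun t' => ⟪u, Y - X t'⟫) (nhdsWithin t (Ioi t)) (nhds ⟪u, Y - X t⟫) :=
    fun u => ((continuous_const.inner (continuous_const.sub h.continuous_X)).tendsto t).mono_left
      nhdsWithin_le_nhds
  refine le_of_tendsto_of_tendsto (hc u) (hc w) ?_
  filter_upwards [self_mem_nhdsWithin] with t' ht'
  exact hlt t' ht'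

lemma inner_velocity_le (h : MonoCurve Vbar X J) {s r t : ℝ} (hs : 0 ≤ s) (hsr : s < r) (hrt : r ≤ t)
    {v w Y : L2} (hv : HasDerivWithinAt X v (Ici s) s) (hw : HasDerivWithinAt X w (Ici r) r)
    (hY : Y ∈ Kcone) : ⟪v - J s, Y - X t⟫ ≤ ⟪w - J r, Y - X t⟫ := by
  refine h.inner_le_of_forall_gt fun t' ht' => ?_
  obtain ⟨B, -, hB, -⟩ := h.incr t'
  refine le_of_tendsto_of_tendsto (tendsto_inner_slope hv _) (tendsto_inner_slope_add hw _ B) ?_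
  have h1 : ∀ᶠ a : ℝ in nhdsWithin 0 (Ioi 0), 0 < a ∧ a ≤ min (r - s) (t' - r) :=
    Ioc_mem_nhdsGT (lt_min (by linarith) (by linarith))
  filter_upwards [h1] with a ha
  have := ha.2.trans (min_le_left _ _)
  have := ha.2.trans (min_le_right _ _)
  exact mul_le_mul_of_nonneg_left (hB s a r t' Y hs ha.1 (by linarith) (by linarith) le_rfl hY)
    (inv_nonneg.2 ha.1.le)

lemma inner_initial_le (h : MonoCurve Vbar X J) {r t : ℝ} (hr : 0 ≤ r) (hrt : r ≤ t)
    {w Y : L2} (hw : HasDerivWithinAt X w (Ici r) r) (hY : Y ∈ Kcone) :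
    ⟪Vbar, Y - X t⟫ ≤ ⟪w - J r, Y - X t⟫ := by
  refine h.inner_le_of_forall_gt fun t' ht' => ?_
  obtain ⟨B, -, -, hB⟩ := h.incr t'
  refine ge_of_tendsto (tendsto_inner_slope_add hw _ B) ?_
  have h1 : ∀ᶠ a : ℝ in nhdsWithin 0 (Ioi 0), 0 < a ∧ a ≤ t' - r := Ioc_mem_nhdsGT (by linarith)
  filter_upwards [h1] with a ha
  rw [le_inv_mul_iff₀ ha.1]
  exact hB a r t' Y ha.1 hr (by linarith) le_rfl hY

lemma mem_normalCone (h : MonoCurve Vbar X J) {s t : ℝ} (hs : 0 ≤ s) (hst : s < t) {v w : L2}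
    (hv : HasDerivWithinAt X v (Ici s) s) (hw : HasDerivWithinAt X w (Ici t) t) :
    (v + (J t - J s)) - w ∈ normalCone (X t) := by
  intro Y hY
  have h1 := h.inner_velocity_le hs hst le_rfl hv hw hY
  have e : (v + (J t - J s)) - w = (v - J s) - (w - J t) := by abel
  rw [e, inner_sub_left]
  linarith

lemma initial_mem_normalCone (h : MonoCurve Vbar X J) {t : ℝ} (ht : 0 ≤ t) {w : L2}
    (hw : HasDerivWithinAt X w (Ici t) t) : (Vbar + J t) - w ∈ normalCone (X t) := by
  intro Y hY
  have h1 := h.inner_initial_le ht le_rfl hw hY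
  have e : (Vbar + J t) - w = Vbar - (w - J t) := by abel
  rw [e, inner_sub_left]
  linarith

lemma inner_eq_zero_of_mem_normalCone (h : MonoCurve Vbar X J) {t : ℝ} {W w : L2}
    (hW : W ∈ normalCone (X t)) (hw : HasDerivAt X w t) : ⟪W, w⟫ = 0 := by
  refine le_antisymm ?_ ?_
  · refine le_of_tendsto ((tendsto_const_nhds (x := W)).inner hw.tendsto_slope_zero_right) ?_
    filter_upwards [self_mem_nhdsWithin] with a ha
    rw [real_inner_smul_right]
    exact mul_nonpos_of_nonneg_of_nonpos (inv_nonneg.2 (le_of_lt ha)) (hW _ (h.mem _))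
  · refine ge_of_tendsto ((tendsto_const_nhds (x := W)).inner hw.tendsto_slope_zero_left) ?_
    filter_upwards [self_mem_nhdsWithin] with a ha
    rw [real_inner_smul_right]
    exact mul_nonneg_of_nonpos_of_nonpos (inv_nonpos.2 (le_of_lt ha)) (hW _ (h.mem _))

/-- Dissipation of the norm of the velocity. -/
lemma norm_sq_jump (h : MonoCurve Vbar X J) {s t : ℝ} (hs : 0 ≤ s) (hst : s < t) {v w : L2}
    (hv : HasDerivWithinAt X v (Ici s) s) (hw : HasDerivAt X w t) :
    ‖(v + (J t - J s)) - w‖ ^ 2 = ‖v + (J t - J s)‖ ^ 2 - ‖w‖ ^ 2 := by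
  have h1 := h.inner_eq_zero_of_mem_normalCone (h.mem_normalCone hs hst hv hw.hasDerivWithinAt) hw
  rw [inner_sub_left, real_inner_self_eq_norm_sq] at h1
  rw [norm_sub_sq_real]
  linarith

lemma neBot_nhdsGT_inf_ae (t : ℝ) : (nhdsWithin t (Ioi t) ⊓ ae (volume : Measure ℝ)).NeBot := by
  refine inf_neBot_iff.2 fun s hs s' hs' => ?_
  obtain ⟨u, hu, hus⟩ := mem_nhdsGT_iff_exists_Ioo_subset.1 hs
  have hne : (ae (volume.restrict (Ioo t u))).NeBot := by
    rw [ae_neBot, Ne, Measure.restrict_eq_zero, Real.volume_Ioo]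
    simpa using hu
  obtain ⟨r, hr1, hr2⟩ := ((ae_restrict_of_ae (μ := volume) (s := Ioo t u) hs').and
    (ae_restrict_mem measurableSet_Ioo)).exists
  exact ⟨r, hus hr2, hr1⟩

lemma cauchy_deriv (h : MonoCurve Vbar X J) {t : ℝ} (ht : 0 ≤ t) :
    Cauchy (map (deriv X) (nhdsWithin t (Ioi t) ⊓ ae volume)) := by
  have hne := neBot_nhdsGT_inf_ae t
  obtain ⟨L, hL0, hL⟩ := exists_norm_deriv_le h.lip_X (t + 1)
  obtain ⟨M, hM⟩ := h.lip_J (t + 1)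
  set G : Set ℝ := {s | HasDerivAt X (deriv X s) s} with hG
  have hGae : G ∈ ae (volume : Measure ℝ) := ae_hasDerivAt h.lip_X
  set m : ℝ → ℝ := fun s => ‖deriv X s‖ - M * s with hm
  have hdJ : ∀ s r, s ≤ r → r ≤ t + 1 → ‖J r - J s‖ ≤ M * (r - s) := by
    intro s r hsr hr
    have := hM.dist_le_mul r hr s (hsr.trans hr)
    rwa [dist_eq_norm, Real.dist_eq, abs_of_nonneg (sub_nonneg.2 hsr)] at this
  have hjump : ∀ s ∈ G, ∀ r ∈ G, t < s → s < r → r < t + 1 →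
      m r ≤ m s ∧ ‖(deriv X s + (J r - J s)) - deriv X r‖ ^ 2 ≤ (2 * L + M) * (m s - m r) := by
    intro s hs r hr hts hsr hr1
    have h1 := h.norm_sq_jump (by linarith) hsr hs.hasDerivWithinAt hr
    have h2 := hdJ s r hsr.le hr1.le
    have h3 := norm_add_le (deriv X s) (J r - J s)
    have h4 : ‖deriv X r‖ ≤ ‖deriv X s + (J r - J s)‖ :=
      abs_le_of_sq_le_sq' (by nlinarith [sq_nonneg ‖(deriv X s + (J r - J s)) - deriv X r‖])
        (norm_nonneg _) |>.2
    have h5 : m r ≤ m s := by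
      simp only [hm]
      linarith
    refine ⟨h5, ?_⟩
    have h6 : ‖deriv X s + (J r - J s)‖ - ‖deriv X r‖ ≤ m s - m r := by
      simp only [hm]
      linarith
    have h7 := hL s (by linarith)
    have h8 := hL r (by linarith)
    have h9 : (M : ℝ) * (r - s) ≤ M := mul_le_of_le_one_right M.2 (by linarith)
    rw [h1, sq_sub_sq]
    have h10 := norm_nonneg (deriv X r)
    have h11 := norm_nonneg (deriv X s + (J r - J s))
    have h12 : ‖deriv X s + (J r - J s)‖ + ‖deriv X r‖ ≤ 2 * L + M := by linarith
    exact mul_le_mul h12 h6 (by linarith) (by linarith)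
  set S : Set ℝ := m '' (G ∩ Ioo t (t + 1)) with hS
  have hSmem : ∀ᶠ s in nhdsWithin t (Ioi t) ⊓ ae volume, s ∈ G ∩ Ioo t (t + 1) :=
    Filter.inter_mem (mem_inf_of_right hGae) (mem_inf_of_left (Ioo_mem_nhdsGT (by linarith)))
  have hSne : S.Nonempty := by
    obtain ⟨s, hs⟩ := hSmem.exists
    exact ⟨_, mem_image_of_mem m hs⟩
  have hSb : BddAbove S := by
    refine ⟨L, ?_⟩
    rintro _ ⟨s, ⟨-, hs1, hs2⟩, rfl⟩
    have : 0 ≤ M * s := mul_nonneg M.2 (by linarith)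
    have := hL s hs2.le
    simp only [hm]
    linarith
  rw [Metric.cauchy_iff]
  refine ⟨hne.map _, fun ε hε => ?_⟩
  have hC : 0 < 2 * L + M + 1 := by linarith [M.2]
  obtain ⟨_, ⟨s₀, ⟨hs₀G, hs₀t, hs₀1⟩, rfl⟩, hs₀⟩ :=
    exists_lt_of_lt_csSup hSne (sub_lt_self (sSup S) (show 0 < (ε / 4) ^ 2 / (2 * L + M + 1) by positivity))
  set δ : ℝ := ε / (4 * (M + 1)) with hδ
  have hM1 : (0 : ℝ) < M + 1 := by linarith [M.2]
  have hδ0 : 0 < δ := by positivity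
  have hδM : M * δ ≤ ε / 4 := by
    rw [hδ, mul_div_assoc', div_le_div_iff₀ (by positivity) (by norm_num)]
    nlinarith
  have hA : G ∩ Ioo t (min s₀ (t + δ)) ∈ nhdsWithin t (Ioi t) ⊓ ae volume :=
    Filter.inter_mem (mem_inf_of_right hGae)
      (mem_inf_of_left (Ioo_mem_nhdsGT (lt_min hs₀t (by linarith))))
  refine ⟨_, image_mem_map hA, ?_⟩
  have key : ∀ s ∈ G ∩ Ioo t (min s₀ (t + δ)), ∀ r ∈ G ∩ Ioo t (min s₀ (t + δ)), s < r →
      dist (deriv X s) (deriv X r) < ε := by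
    rintro s ⟨hsG, hst, hs⟩ r ⟨hrG, hrt, hr⟩ hsr
    have hr0 := hr.trans_le (min_le_left _ _)
    have hrδ := hr.trans_le (min_le_right _ _)
    obtain ⟨-, h1⟩ := hjump s hsG r hrG hst hsr (by linarith)
    have h2 := (hjump r hrG s₀ hs₀G hrt hr0 hs₀1).1
    have h3 : m s ≤ sSup S := le_csSup hSb ⟨s, ⟨hsG, hst, by linarith⟩, rfl⟩
    have h4 : m s - m r ≤ (ε / 4) ^ 2 / (2 * L + M + 1) := by linarith
    have h5 : (2 * L + M) * (m s - m r) ≤ (ε / 4) ^ 2 := by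
      rw [le_div_iff₀ hC] at h4
      have := (hjump s hsG r hrG hst hsr (by linarith)).1
      nlinarith
    have h6 : ‖(deriv X s + (J r - J s)) - deriv X r‖ ≤ ε / 4 :=
      abs_le_of_sq_le_sq' (h1.trans h5) (by positivity) |>.2
    have h7 := hdJ s r hsr.le (by linarith)
    have h8 : M * (r - s) ≤ M * δ := mul_le_mul_of_nonneg_left (by linarith) M.2
    have e : deriv X s - deriv X r = ((deriv X s + (J r - J s)) - deriv X r) - (J r - J s) := by abel
    rw [dist_eq_norm, e]
    refine (norm_sub_le _ _).trans_lt ?_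
    linarith
  rintro _ ⟨s, hs, rfl⟩ _ ⟨r, hr, rfl⟩
  rcases lt_trichotomy s r with hsr | rfl | hsr
  · exact key s hs r hr hsr
  · rwa [dist_self]
  · rw [dist_comm]
    exact key r hr s hs hsr

lemma exists_rightDeriv (h : MonoCurve Vbar X J) {t : ℝ} (ht : 0 ≤ t) :
    ∃ v, HasDerivWithinAt X v (Ici t) t := by
  obtain ⟨v, hv⟩ := CompleteSpace.complete (h.cauchy_deriv ht)
  refine ⟨v, ?_⟩
  have h1 : HasDerivWithinAt (fun u => ∫ s in t..u, deriv X s) v (Ici t) t :=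
    intervalIntegral.integral_hasDerivWithinAt_of_tendsto_ae_right (t := Ioi t)
      (intervalIntegrable_deriv h.lip_X t t)
      (stronglyMeasurable_deriv X).aestronglyMeasurable.stronglyMeasurableAtFilter hv
  refine (h1.const_add (X t)).congr (fun u hu => ?_) ?_
  · rw [intervalIntegral.integral_of_le hu, integral_deriv_eq h.lip_X hu]
    abel
  · simp

/-- The projection formula. -/
lemma isProjK (h : MonoCurve Vbar X J) {s t : ℝ} (hs : 0 ≤ s) (hst : s ≤ t) {v : L2}
    (hv : HasDerivWithinAt X v (Ici s) s) :
    IsProjK (X s + (t - s) • v + ∫ r in Ioc s t, (t - r) • deriv J r) (X t) := by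
  refine isProjK_of_mem_normalCone (h.mem t) fun Y hY => ?_
  set D : L2 := Y - X t with hD
  rw [integral_weight_deriv h.lip_J hst]
  have hi1 : IntegrableOn (deriv X) (Ioc s t) :=
    (intervalIntegrable_iff_integrableOn_Ioc_of_le hst).1 (intervalIntegrable_deriv h.lip_X s t)
  have hi2 : IntegrableOn (fun r => J r - J s) (Ioc s t) :=
    ((h.continuous_J.sub continuous_const).integrableOn_Icc).mono_set Ioc_subset_Icc_self
  have hc : ∫ _ in Ioc s t, v = (t - s) • v := by
    simp [hst]
  have hX := integral_deriv_eq h.lip_X hst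
  have hvi : IntegrableOn (fun _ : ℝ => v) (Ioc s t) := by simp
  have hi3 : IntegrableOn (fun r => v + (J r - J s)) (Ioc s t) := hvi.add hi2
  have hi4 : IntegrableOn (fun r => v + (J r - J s) - deriv X r) (Ioc s t) := hi3.sub hi1
  have e : X s + (t - s) • v + (∫ r in Ioc s t, (J r - J s)) - X t =
      ∫ r in Ioc s t, (v + (J r - J s) - deriv X r) := by
    rw [integral_sub hi3 hi1, integral_add hvi hi2, hc, hX]
    abel
  rw [e, real_inner_comm, ← integral_inner hi4 D]
  refine integral_nonpos_of_ae ?_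
  filter_upwards [ae_restrict_mem measurableSet_Ioc, ae_restrict_of_ae (ae_hasDerivAt h.lip_X)]
    with r hr hd
  have h1 := h.inner_velocity_le hs hr.1 hr.2 hv hd.hasDerivWithinAt hY
  have e1 : v + (J r - J s) - deriv X r = (v - J s) - (deriv X r - J r) := by abel
  rw [real_inner_comm, e1, inner_sub_left]
  exact sub_nonpos.2 h1

end MonoCurve

/-! ### Existence -/

namespace Family

variable {F : L2 → L2} {Xbar Vbar : L2} {x v z : ℕ → ℕ → L2} {U : Ultrafilter ℕ} {X J : ℝ → L2}

lemma monoCurve (h : Family F Xbar Vbar x v z) (hF : UnifCont F) (hL : IsLimit U x z X J) :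
    MonoCurve Vbar X J := by
  have lip : ∀ {f : ℝ → L2} {T B : ℝ}, 0 ≤ B →
      (∀ s t, s ≤ t → t ≤ T → ‖f t - f s‖ ≤ B * (t - s)) →
      LipschitzOnWith B.toNNReal f (Iic T) := by
    intro f T B hB0 hB
    refine LipschitzOnWith.of_dist_le_mul fun s hs t ht => ?_
    rw [Real.coe_toNNReal B hB0]
    rcases le_total s t with hst | hst
    · rw [dist_comm, dist_comm s t, dist_eq_norm, Real.dist_eq, abs_of_nonneg (sub_nonneg.2 hst)]
      exact hB s t hst ht
    · rw [dist_eq_norm, Real.dist_eq, abs_of_nonneg (sub_nonneg.2 hst)]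
      exact hB t s hst hs
  refine ⟨h.limit_mem hL, J_of_nonpos hL le_rfl, fun T => ?_, fun T => ?_,
    h.exists_increment_le hF hL⟩
  · obtain ⟨B, hB0, hB⟩ := h.exists_lipschitz hF hL T
    exact ⟨_, lip hB0 fun s t hst ht => (hB s t hst ht).1⟩
  · obtain ⟨B, hB0, hB⟩ := h.exists_lipschitz hF hL T
    exact ⟨_, lip hB0 fun s t hst ht => (hB s t hst ht).2⟩

end Family

/-- **Existence of generalized Lagrangian solutions.** If `F` is pointwise
linearly bounded and uniformly continuous, then for every `X̄ ∈ K` and `V̄ ∈ H_{X̄}` there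
exists a generalized Lagrangian solution with initial data `(X̄, V̄)`. -/
theorem stmt18 (F : L2 → L2) (Cp : ℝ) (hptw : PtwLinBdd F Cp) (hF : UnifCont F)
    (Xbar : L2) (hXbar : Xbar ∈ Kcone) (Vbar : L2) (hVbar : Vbar ∈ HX Xbar) :
    ∃ X V Z : ℝ → L2, GenLagSol F Xbar Vbar X V Z := by
  choose x v z hsch using fun n => exists_scheme F Xbar Vbar (tau n)
  have h : Family F Xbar Vbar x v z := ⟨hsch, hXbar, HX_subset_HM hXbar hVbar⟩
  obtain ⟨X, J, hL⟩ := h.exists_isLimit hptw hF (Ultrafilter.of_le atTop)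
  have hM := h.monoCurve hF hL
  choose! V hV using fun (t : ℝ) (ht : 0 ≤ t) => hM.exists_rightDeriv ht
  have hJd := ae_hasDerivAt hM.lip_J
  refine ⟨X, V, deriv J, fun t _ => hM.mem t, h.X_of_nonpos hL le_rfl, fun T => ?_, hV,
    (stronglyMeasurable_deriv J).aestronglyMeasurable, fun T _ => ?_, ?_, ?_, ?_, ?_⟩
  · obtain ⟨K, hK⟩ := hM.lip_X T
    exact ⟨K, hK.mono Icc_subset_Iic_self⟩
  · obtain ⟨K, -, hK⟩ := exists_norm_deriv_le hM.lip_J T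
    refine ⟨K, ?_⟩
    filter_upwards [ae_restrict_mem measurableSet_Ioc] with t ht
    exact hK t ht.2
  · filter_upwards [ae_restrict_mem measurableSet_Ioi, ae_restrict_of_ae hJd] with t ht hd
    exact ⟨h.deriv_sub_mem_HXperp hF hL (le_of_lt ht) hd, dominated_of_lipschitz fun ψ k hc hl =>
      h.integral_compL2_deriv_le hF hL (le_of_lt ht) hd hc hl⟩
  · filter_upwards [ae_restrict_mem measurableSet_Ioi, ae_restrict_of_ae (ae_hasDerivAt hM.lip_X)]
      with t ht hd
    refine ⟨_, hd, ?_⟩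
    rw [integral_deriv_eq hM.lip_J (le_of_lt ht), hM.J_zero, sub_zero]
    exact hM.initial_mem_normalCone (le_of_lt ht) hd.hasDerivWithinAt
  · intro s t hs hst
    rcases hst.eq_or_lt with rfl | hlt
    · intro Y _
      simp
    · rw [integral_deriv_eq hM.lip_J hst]
      exact hM.mem_normalCone hs hlt (hV s hs) (hV t (hs.trans hst))
  · exact fun s t hs hst => hM.isProjK hs hst (hV s hs)
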